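/- arXiv:2312.12626 — 2 statements merged into one kernel-verified Lean document; each statement's English description precedes it below -/
import Mathlib

section
/- Fix an integer n ≥ 1 and a nonzero polynomial F ∈ ℂ[X]. For every ε > 0 there exists H₀ such that for all integers H ≥ H₀, the number of matrices A ∈ M_n(ℤ;H) with det F(A) = 0 is at most H^(n² − n + ε), where F(A) denotes the evaluation of F at the matrix A viewed as a complex n×n matrix. -/
open Matrix Polynomial

section Part1

noncomputable def zbox (κ : Type) [Fintype κ] (H : ℕ) : Finset (κ → ℤ) := by
  classical exact Fintype.piFinset fun _ => Finset.Icc (-(H : ℤ)) H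

noncomputable def mbox (ι κ : Type) [Fintype ι] [Fintype κ] (H : ℕ) : Finset (ι → κ → ℤ) := by
  classical exact Fintype.piFinset fun _ => zbox κ H

section boxes
variable {ι κ : Type} [Fintype ι] [Fintype κ]

lemma mem_zbox {H : ℕ} {x : κ → ℤ} : x ∈ zbox κ H ↔ ∀ i, |x i| ≤ H := by
  simp [zbox, abs_le]

lemma mem_mbox {H : ℕ} {x : ι → κ → ℤ} : x ∈ mbox ι κ H ↔ ∀ i, x i ∈ zbox κ H := by
  simp [mbox]

lemma card_zbox (H : ℕ) : (zbox κ H).card = (2 * H + 1) ^ Fintype.card κ := by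
  classical
  simp only [zbox, Fintype.card_piFinset, Int.card_Icc, Finset.prod_const, Finset.card_univ]
  congr 1
  omega

lemma card_mbox (H : ℕ) :
    (mbox ι κ H).card = (2 * H + 1) ^ (Fintype.card ι * Fintype.card κ) := by
  classical
  simp only [mbox, Fintype.card_piFinset, card_zbox, Finset.prod_const, Finset.card_univ]
  rw [← pow_mul, mul_comm (Fintype.card κ)]

lemma reduce_mod [DecidableEq κ] {H : ℕ} (M : ι → κ → ℤ) (hM : ∀ i, M i ∈ zbox κ H) (v : κ → ℤ)
    (hMv : ∀ i, M i ⬝ᵥ v = 0) (i0 : κ)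
    (hker : ∀ u : κ → ℚ, (∀ i, ∑ j, (M i j : ℚ) * u j = 0) → u i0 = 0 → u = 0) (y : κ → ℤ) :
    ∃ z : κ → ℤ, z ⬝ᵥ v = y ⬝ᵥ v ∧ ∀ j, j ≠ i0 → |z j| ≤ (Fintype.card ι * H : ℕ) := by
  let g : Option ι → (κ → ℚ) := fun o => o.elim (Pi.single i0 1) (fun i j => (M i j : ℚ))
  have htop : Submodule.span ℚ (Set.range g) = ⊤ := by
    by_contra hne
    obtain ⟨f, hf0, hf⟩ := Submodule.exists_le_ker_of_lt_top _ (lt_top_iff_ne_top.2 hne)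
    apply hf0
    have hfx : ∀ x : κ → ℚ, f x = ∑ j, x j * f (Pi.single j 1) := by
      intro x
      rw [LinearMap.pi_apply_eq_sum_univ f x]
      refine Finset.sum_congr rfl fun j _ => ?_
      simp only [smul_eq_mul]
      congr 2
      ext k
      simp [Pi.single_apply, eq_comm]
    have h0 : ∀ o, f (g o) = 0 := fun o => hf (Submodule.subset_span ⟨o, rfl⟩)
    have := hker (fun j => f (Pi.single j 1)) (fun i => by
      have := h0 (some i)
      rw [hfx] at this
      exact this) (h0 none)
    ext x
    have h3 := congrFun this
    simp only [Pi.zero_apply] at h3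
    simp [h3]
  have hy : (fun j => (y j : ℚ)) ∈ Submodule.span ℚ (Set.range g) := htop ▸ Submodule.mem_top
  obtain ⟨c, hc⟩ := (Submodule.mem_span_range_iff_exists_fun ℚ).1 hy
  refine ⟨fun j => y j - ∑ i, ⌊c (some i)⌋ * M i j, ?_, ?_⟩
  · have : (fun j => y j - ∑ i, ⌊c (some i)⌋ * M i j) = y - ∑ i, ⌊c (some i)⌋ • M i := by
      ext j; simp
    rw [this, sub_dotProduct, sum_dotProduct]
    simp only [smul_dotProduct, hMv, smul_zero, Finset.sum_const_zero, sub_zero]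
  · intro j hj
    have h1 := congrFun hc j
    simp only [Fintype.sum_option, g, Option.elim, Pi.smul_apply, Finset.sum_apply,
      Pi.single_apply, hj, if_false, smul_eq_mul, mul_zero, zero_add] at h1
    have h2 : ((y j - ∑ i, ⌊c (some i)⌋ * M i j : ℤ) : ℚ)
        = ∑ i, Int.fract (c (some i)) * (M i j : ℚ) := by
      push_cast
      rw [← h1, ← Finset.sum_sub_distrib]
      refine Finset.sum_congr rfl fun i _ => ?_
      rw [Int.fract]; ring
    have h3 : |((y j - ∑ i, ⌊c (some i)⌋ * M i j : ℤ) : ℚ)| ≤ (Fintype.card ι * H : ℕ) := by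
      rw [h2]
      refine (Finset.abs_sum_le_sum_abs _ _).trans ?_
      have : ∀ i ∈ Finset.univ, |Int.fract (c (some i)) * (M i j : ℚ)| ≤ (H : ℚ) := by
        intro i _
        rw [abs_mul, abs_of_nonneg (Int.fract_nonneg _)]
        have h4 : |(M i j : ℚ)| ≤ H := by exact_mod_cast mem_zbox.1 (hM i) j
        have h5 := (Int.fract_lt_one (c (some i))).le
        have h6 := Int.fract_nonneg (c (some i))
        nlinarith [abs_nonneg (M i j : ℚ)]
      refine (Finset.sum_le_card_nsmul _ _ _ this).trans ?_
      simp
    exact_mod_cast h3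

lemma packing [DecidableEq κ] {H : ℕ} (M : ι → κ → ℤ) (hM : ∀ i, M i ∈ zbox κ H) (v : κ → ℤ)
    (hMv : ∀ i, M i ⬝ᵥ v = 0) (i0 : κ) (hv0 : v i0 ≠ 0) (hprim : ∃ y : κ → ℤ, y ⬝ᵥ v = 1)
    (hker : ∀ u : κ → ℚ, (∀ i, ∑ j, (M i j : ℚ) * u j = 0) → u i0 = 0 → u = 0) :
    (v i0).natAbs * ((zbox κ H).filter fun x => x ⬝ᵥ v = 0).card ≤
      (2 * ((Fintype.card ι + 1) * H) + 1) ^ (Fintype.card κ - 1) := by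
  obtain ⟨y, hy⟩ := hprim
  have hz : ∀ s : ℕ, ∃ z : κ → ℤ, z ⬝ᵥ v = s ∧
      ∀ j, j ≠ i0 → |z j| ≤ (Fintype.card ι * H : ℕ) := by
    intro s
    obtain ⟨z, h1, h2⟩ := reduce_mod M hM v hMv i0 hker ((s : ℤ) • y)
    refine ⟨z, ?_, h2⟩
    rw [h1, smul_dotProduct, hy]; simp
  choose z hz1 hz2 using hz
  have hcard : Fintype.card {j : κ // j ≠ i0} = Fintype.card κ - 1 := by
    simp [Fintype.card_subtype_compl]
  rw [← hcard, ← card_zbox, ← Finset.card_range (v i0).natAbs, ← Finset.card_product]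
  refine Finset.card_le_card_of_injOn (fun p => fun j => z p.1 j.1 + p.2 j.1) ?_ ?_
  · rintro ⟨s, x⟩ hp
    simp only [Finset.coe_product, Set.mem_prod, Finset.mem_coe, Finset.mem_filter] at hp
    simp only [Finset.mem_coe, mem_zbox]
    intro j
    have h1 := hz2 s j.1 j.2
    have h2 := mem_zbox.1 hp.2.1 j.1
    refine (abs_add_le _ _).trans ?_
    push_cast at *
    linarith
  · rintro ⟨s, x⟩ hp ⟨s', x'⟩ hp' heq
    simp only [Finset.coe_product, Set.mem_prod, Finset.mem_coe, Finset.mem_filter,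
      Finset.mem_range] at hp hp'
    have hj : ∀ j, j ≠ i0 → z s j + x j = z s' j + x' j := fun j hj => congrFun heq ⟨j, hj⟩
    have hdot : (z s + x - (z s' + x')) ⬝ᵥ v = (s : ℤ) - s' := by
      rw [sub_dotProduct, add_dotProduct, add_dotProduct, hz1, hz1, hp.2.2, hp'.2.2]; ring
    have hdot2 : (z s + x - (z s' + x')) ⬝ᵥ v =
        (z s i0 + x i0 - (z s' i0 + x' i0)) * v i0 := by
      rw [dotProduct, Finset.sum_eq_single i0]
      · simp
      · intro j _ hj'
        simp [hj j hj']
      · simp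
    have hs : s = s' := by
      have hd : v i0 ∣ (s : ℤ) - s' := ⟨_, by rw [← hdot, hdot2, mul_comm]⟩
      have h1 := hp.1
      have h2 := hp'.1
      have := Int.eq_zero_of_abs_lt_dvd ((abs_dvd _ _).2 hd) (by
        rw [Int.abs_eq_natAbs (v i0), abs_lt]; omega)
      omega
    subst hs
    have h0 : z s i0 + x i0 - (z s i0 + x' i0) = 0 := by
      have : (z s i0 + x i0 - (z s i0 + x' i0)) * v i0 = 0 := by rw [← hdot2, hdot]; simp
      exact (mul_eq_zero.1 this).resolve_right hv0
    have : x = x' := by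
      ext j
      by_cases h : j = i0
      · subst h; linarith
      · have := hj j h; linarith
    rw [this]

end boxes

end Part1

section Part2

lemma pow_sub_bound (t k : ℕ) (ht : 1 ≤ t) :
    (2 * t + 1) ^ k ≤ (2 * (t - 1) + 1) ^ k + 2 * k * (2 * t + 1) ^ (k - 1) := by
  obtain ⟨s, rfl⟩ : ∃ s, t = s + 1 := ⟨t - 1, by omega⟩
  simp only [Nat.add_sub_cancel]
  induction k with
  | zero => simp
  | succ k ih =>
    simp only [Nat.add_sub_cancel]
    rcases Nat.eq_zero_or_pos k with rfl | hk
    · simp; omega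
    · have h1 : (2 * (s + 1) + 1) ^ k = (2 * (s + 1) + 1) ^ (k - 1) * (2 * (s + 1) + 1) := by
        rw [← pow_succ]; congr 1; omega
      have h2 : (2 * s + 1) ^ k ≤ (2 * (s + 1) + 1) ^ k := Nat.pow_le_pow_left (by omega) _
      calc (2 * (s + 1) + 1) ^ (k + 1) = (2 * s + 1) * (2 * (s + 1) + 1) ^ k
            + 2 * (2 * (s + 1) + 1) ^ k := by ring
        _ ≤ (2 * s + 1) * ((2 * s + 1) ^ k + 2 * k * (2 * (s + 1) + 1) ^ (k - 1))
            + 2 * (2 * (s + 1) + 1) ^ k := by gcongr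
        _ ≤ (2 * s + 1) * (2 * s + 1) ^ k + 2 * k * ((2 * (s + 1) + 1) ^ (k - 1)
            * (2 * (s + 1) + 1)) + 2 * (2 * (s + 1) + 1) ^ k := by
              have : (2 * s + 1) * (2 * k * (2 * (s + 1) + 1) ^ (k - 1)) ≤
                2 * k * ((2 * (s + 1) + 1) ^ (k - 1) * (2 * (s + 1) + 1)) := by
                rw [mul_comm (2 * s + 1), mul_assoc (2 * k)]
                gcongr
                omega
              rw [mul_add]
              omega
        _ = _ := by rw [← h1]; ring

section circ
variable {ι κ : Type} [Fintype ι] [Fintype κ]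

/-- sup norm of an integer vector -/
def znorm (v : κ → ℤ) : ℕ := Finset.univ.sup fun i => (v i).natAbs

lemma mem_zbox_iff {v : κ → ℤ} {H : ℕ} : v ∈ zbox κ H ↔ znorm v ≤ H := by
  rw [mem_zbox, znorm, Finset.sup_le_iff]
  refine forall_congr' fun i => ?_
  simp only [Finset.mem_univ, true_imp_iff]
  rw [Int.abs_eq_natAbs]
  omega

lemma sphere_card (T t : ℕ) (ht : 1 ≤ t) :
    ((zbox κ T).filter fun v => znorm v = t).card ≤
      2 * Fintype.card κ * (2 * t + 1) ^ (Fintype.card κ - 1) := by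
  classical
  have h1 : ((zbox κ T).filter fun v => znorm v = t) ⊆ zbox κ t \ zbox κ (t - 1) := by
    intro v hv
    rw [Finset.mem_filter] at hv
    rw [Finset.mem_sdiff, mem_zbox_iff, mem_zbox_iff]
    omega
  refine (Finset.card_le_card h1).trans ?_
  have h2 : zbox κ (t - 1) ⊆ zbox κ t := by
    intro v; rw [mem_zbox_iff, mem_zbox_iff]; omega
  rw [Finset.card_sdiff_of_subset h2, card_zbox, card_zbox]
  have := pow_sub_bound t (Fintype.card κ) ht
  omega

lemma sum_inv_bound (T : ℕ) (hk : 1 ≤ Fintype.card κ) :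
    ∑ v ∈ (zbox κ T).filter (fun v => 1 ≤ znorm v), (1 / (znorm v : ℝ) ^ Fintype.card κ) ≤
      2 * Fintype.card κ * 3 ^ (Fintype.card κ - 1) * (1 + Real.log T) := by
  classical
  set k := Fintype.card κ
  have h1 : ∀ v ∈ (zbox κ T).filter (fun v => 1 ≤ znorm v), znorm v ∈ Finset.Icc 1 T := by
    intro v hv
    rw [Finset.mem_filter, mem_zbox_iff] at hv
    simp; omega
  rw [← Finset.sum_fiberwise_of_maps_to h1]
  have h2 : ∀ t ∈ Finset.Icc 1 T, ∑ v ∈ ((zbox κ T).filter (fun v => 1 ≤ znorm v)).filter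
      (fun v => znorm v = t), (1 / (znorm v : ℝ) ^ k) ≤
      (2 * k * 3 ^ (k - 1)) * (t : ℝ)⁻¹ := by
    intro t ht
    have ht1 : 1 ≤ t := (Finset.mem_Icc.1 ht).1
    have ht0 : (0 : ℝ) < t := by exact_mod_cast ht1
    have hs : ∑ v ∈ ((zbox κ T).filter (fun v => 1 ≤ znorm v)).filter
      (fun v => znorm v = t), (1 / (znorm v : ℝ) ^ k) =
      ∑ v ∈ ((zbox κ T).filter (fun v => 1 ≤ znorm v)).filter
      (fun v => znorm v = t), (1 / (t : ℝ) ^ k) := by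
      refine Finset.sum_congr rfl fun v hv => ?_
      rw [(Finset.mem_filter.1 hv).2]
    rw [hs, Finset.sum_const, nsmul_eq_mul]
    have hc : ((((zbox κ T).filter (fun v => 1 ≤ znorm v)).filter
      (fun v => znorm v = t)).card : ℝ) ≤ 2 * k * (3 * t) ^ (k - 1) := by
      have h3 : (((zbox κ T).filter (fun v => 1 ≤ znorm v)).filter
        (fun v => znorm v = t)).card ≤ 2 * k * (3 * t) ^ (k - 1) := by
        refine (Finset.card_le_card ?_).trans ((sphere_card T t ht1).trans ?_)
        · intro v hv
          simp only [Finset.mem_filter] at hv ⊢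
          exact ⟨hv.1.1, hv.2⟩
        · gcongr; omega
      exact_mod_cast h3
    calc _ ≤ (2 * k * (3 * t) ^ (k - 1)) * (1 / (t : ℝ) ^ k) := by gcongr
      _ = _ := by
        have : (t : ℝ) ^ k = t ^ (k - 1) * t := by rw [← pow_succ]; congr 1; omega
        rw [this, mul_pow]
        field_simp
  refine (Finset.sum_le_sum h2).trans ?_
  rw [← Finset.mul_sum]
  gcongr
  have := harmonic_le_one_add_log T
  rw [harmonic_eq_sum_Icc] at this
  push_cast at this
  exact this

open Classical in
/-- integer matrices in the box with one-dimensional kernel -/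
noncomputable def circ (ι κ : Type) [Fintype ι] [Fintype κ] (H : ℕ) : Finset (ι → κ → ℤ) :=
  (mbox ι κ H).filter fun M => ∃ v : κ → ℤ, v ≠ 0 ∧ (∀ i, M i ⬝ᵥ v = 0) ∧
    ∀ u : κ → ℚ, (∀ i, ∑ j, (M i j : ℚ) * u j = 0) → ∃ c : ℚ, ∀ j, u j = c * v j

lemma mem_circ {H : ℕ} {M : ι → κ → ℤ} : M ∈ circ ι κ H ↔ M ∈ mbox ι κ H ∧
    ∃ v : κ → ℤ, v ≠ 0 ∧ (∀ i, M i ⬝ᵥ v = 0) ∧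
    ∀ u : κ → ℚ, (∀ i, ∑ j, (M i j : ℚ) * u j = 0) → ∃ c : ℚ, ∀ j, u j = c * v j := by
  classical
  rw [circ, Finset.mem_filter]

lemma circ_prim {H : ℕ} {M : ι → κ → ℤ} (hM : M ∈ circ ι κ H) :
    ∃ v : κ → ℤ, (∃ y : κ → ℤ, y ⬝ᵥ v = 1) ∧ (∀ i, M i ⬝ᵥ v = 0) ∧
    ∀ u : κ → ℚ, (∀ i, ∑ j, (M i j : ℚ) * u j = 0) → ∃ c : ℚ, ∀ j, u j = c * v j := by
  obtain ⟨v, hv0, hMv, hu⟩ := (mem_circ.1 hM).2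
  obtain ⟨j0, hj0⟩ := Function.ne_iff.1 hv0
  obtain ⟨g, hg, hg1⟩ := Finset.extract_gcd (s := Finset.univ) v ⟨j0, Finset.mem_univ _⟩
  set d := Finset.univ.gcd v
  have hvg : v = d • g := by ext j; simpa using hg j (Finset.mem_univ _)
  have hd : d ≠ 0 := by
    intro h; rw [h] at hvg; simp [hvg] at hj0
  obtain ⟨f, hf⟩ := Finset.gcd_eq_sum_mul Finset.univ g
  refine ⟨g, ⟨f, ?_⟩, ?_, ?_⟩
  · rw [← hg1, hf, dotProduct]
    refine Finset.sum_congr rfl fun j _ => ?_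
    ring
  · intro i
    have := hMv i
    rw [hvg, dotProduct_smul, smul_eq_mul] at this
    exact (mul_eq_zero.1 this).resolve_left hd
  · intro u h
    obtain ⟨c, hc⟩ := hu u h
    refine ⟨c * d, fun j => ?_⟩
    rw [hc j, hvg]
    simp; ring

lemma circ_pack {H : ℕ} {M : ι → κ → ℤ} (hM : M ∈ circ ι κ H) :
    ∃ v : κ → ℤ, 1 ≤ znorm v ∧ (∀ i, M i ⬝ᵥ v = 0) ∧
      znorm v * ((zbox κ H).filter fun x => x ⬝ᵥ v = 0).card ≤
      (2 * ((Fintype.card ι + 1) * H) + 1) ^ (Fintype.card κ - 1) := by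
  classical
  obtain ⟨v, hprim, hMv, hu⟩ := circ_prim hM
  have hv0 : v ≠ 0 := by
    rintro rfl
    obtain ⟨y, hy⟩ := hprim
    simp at hy
  obtain ⟨j0, hj0⟩ := Function.ne_iff.1 hv0
  obtain ⟨i0, -, hi0⟩ := Finset.exists_mem_eq_sup Finset.univ ⟨j0, Finset.mem_univ _⟩
    (fun i => (v i).natAbs)
  have hle : (v j0).natAbs ≤ znorm v := Finset.le_sup (f := fun i => (v i).natAbs)
    (Finset.mem_univ j0)
  have hi0' : znorm v = (v i0).natAbs := hi0
  have hj0' : v j0 ≠ 0 := hj0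
  have h1 : 1 ≤ znorm v := by omega
  have hvi : v i0 ≠ 0 := by intro h; rw [h] at hi0'; simp at hi0'; omega
  refine ⟨v, h1, hMv, ?_⟩
  rw [hi0']
  have hbox := mem_mbox.1 (mem_circ.1 hM).1
  refine packing M hbox v hMv i0 hvi hprim ?_
  intro u h hui
  obtain ⟨c, hc⟩ := hu u h
  have : c = 0 := by
    have := hc i0
    rw [hui] at this
    rcases mul_eq_zero.1 this.symm with h | h
    · exact h
    · exact absurd (by exact_mod_cast h) hvi
  ext j
  rw [hc j, this]; simp

lemma circ_bound_aux (H : ℕ) (hk : 1 ≤ Fintype.card κ) (hkm : Fintype.card κ ≤ Fintype.card ι)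
    (D : ℕ) (hD : D = (2 * ((Fintype.card ι + 1) * H) + 1) ^ (Fintype.card κ - 1)) :
    ((circ ι κ H).card : ℝ) ≤ (D : ℝ) ^ Fintype.card ι *
      (2 * Fintype.card κ * 3 ^ (Fintype.card κ - 1) * (1 + Real.log D)) := by
  classical
  set k := Fintype.card κ
  set m := Fintype.card ι
  set X : (κ → ℤ) → Finset (κ → ℤ) := fun v => (zbox κ H).filter fun x => x ⬝ᵥ v = 0
  set V := ((zbox κ D).filter (fun v => 1 ≤ znorm v)).filter (fun v => znorm v * (X v).card ≤ D)
  have hsub : circ ι κ H ⊆ V.biUnion fun v => Fintype.piFinset fun _ : ι => X v := by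
    intro M hM
    obtain ⟨v, h1, h2, h3⟩ := circ_pack hM
    have hbox := mem_mbox.1 (mem_circ.1 hM).1
    rw [← hD] at h3
    rw [Finset.mem_biUnion]
    refine ⟨v, ?_, ?_⟩
    · simp only [V, Finset.mem_filter, mem_zbox_iff]
      refine ⟨⟨?_, h1⟩, h3⟩
      have : 1 ≤ (X v).card := Finset.card_pos.2 ⟨0, by simp [X, mem_zbox]⟩
      calc znorm v = znorm v * 1 := by simp
        _ ≤ znorm v * (X v).card := by gcongr
        _ ≤ D := h3
    · rw [Fintype.mem_piFinset]
      intro i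
      simp [X, hbox i, h2 i]
  have hcard : (circ ι κ H).card ≤ ∑ v ∈ V, (X v).card ^ m := by
    refine (Finset.card_le_card hsub).trans (Finset.card_biUnion_le.trans ?_)
    simp [Fintype.card_piFinset, m]
  have h5 : ((circ ι κ H).card : ℝ) ≤ ∑ v ∈ V, ((X v).card : ℝ) ^ m := by exact_mod_cast hcard
  have h6 : ∀ v ∈ V, ((X v).card : ℝ) ^ m ≤ (D : ℝ) ^ m * (1 / (znorm v : ℝ) ^ k) := by
    intro v hv
    simp only [V, Finset.mem_filter] at hv
    obtain ⟨⟨-, h1⟩, h3⟩ := hv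
    have h1' : (1 : ℝ) ≤ znorm v := by exact_mod_cast h1
    have h3' : (znorm v : ℝ) * (X v).card ≤ D := by exact_mod_cast h3
    rw [mul_one_div, le_div_iff₀ (by positivity)]
    calc ((X v).card : ℝ) ^ m * (znorm v : ℝ) ^ k ≤ ((X v).card : ℝ) ^ m * (znorm v : ℝ) ^ m := by
          gcongr
      _ = ((znorm v : ℝ) * (X v).card) ^ m := by rw [mul_pow, mul_comm]
      _ ≤ _ := by gcongr
  refine h5.trans ((Finset.sum_le_sum h6).trans ?_)
  rw [← Finset.mul_sum]
  gcongr
  refine le_trans ?_ (sum_inv_bound D hk)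
  exact Finset.sum_le_sum_of_subset_of_nonneg (Finset.filter_subset _ _)
    (fun _ _ _ => by positivity)

def Bd (f : ℕ → ℕ) (a : ℕ) : Prop :=
  ∃ C : ℝ, 0 < C ∧ ∀ H : ℕ, 1 ≤ H → (f H : ℝ) ≤ C * (H : ℝ) ^ a * (1 + Real.log H)

lemma circ_bound (hk : 1 ≤ Fintype.card κ) (hkm : Fintype.card κ ≤ Fintype.card ι) :
    Bd (fun H => (circ ι κ H).card) (Fintype.card ι * (Fintype.card κ - 1)) := by
  obtain ⟨k, hk'⟩ : ∃ k, Fintype.card κ = k + 1 := ⟨_, (Nat.sub_add_cancel hk).symm⟩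
  set m := Fintype.card ι with hm
  set c : ℕ := 2 * m + 3
  have hc1 : (1 : ℝ) ≤ c := by exact_mod_cast (by omega : 1 ≤ c)
  have hlc : 0 ≤ Real.log c := Real.log_nonneg hc1
  refine ⟨((c : ℝ) ^ k) ^ m * (2 * (k + 1 : ℕ) * 3 ^ k) * (1 + k * (Real.log c + 1)), by positivity,
    fun H hH => ?_⟩
  have hH1 : (1 : ℝ) ≤ H := by exact_mod_cast hH
  have hlH : 0 ≤ Real.log H := Real.log_nonneg hH1
  refine (circ_bound_aux H hk hkm _ rfl).trans ?_
  rw [hk', Nat.add_sub_cancel, ← hm]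
  have hDle : (2 * ((m + 1) * H) + 1) ^ k ≤ (c * H) ^ k := by
    gcongr
    simp only [c]; nlinarith
  have hDle' : (((2 * ((m + 1) * H) + 1) ^ k : ℕ) : ℝ) ≤ ((c : ℝ) * H) ^ k := by exact_mod_cast hDle
  have hDpos : 0 < (2 * ((m + 1) * H) + 1) ^ k := by positivity
  set D := (2 * ((m + 1) * H) + 1) ^ k
  have hD1 : (1 : ℝ) ≤ D := by exact_mod_cast hDpos
  have hlog : 1 + Real.log D ≤ (1 + k * (Real.log c + 1)) * (1 + Real.log H) := by
    have : Real.log D ≤ k * (Real.log c + Real.log H) := by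
      rw [← Real.log_mul (by positivity) (by positivity), ← Real.log_pow]
      exact Real.log_le_log (by positivity) hDle'
    have h2 : 0 ≤ (k : ℝ) * Real.log c * Real.log H := by positivity
    have h3 : 0 ≤ (k : ℝ) := by positivity
    nlinarith
  have hlD : 0 ≤ Real.log D := Real.log_nonneg hD1
  calc (D : ℝ) ^ m * (2 * (k + 1 : ℕ) * 3 ^ k * (1 + Real.log D))
      ≤ (((c : ℝ) * H) ^ k) ^ m * (2 * (k + 1 : ℕ) * 3 ^ k *
        ((1 + k * (Real.log c + 1)) * (1 + Real.log H))) := by gcongr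
    _ = _ := by
      rw [mul_pow, mul_pow, ← pow_mul (H : ℝ), mul_comm k m]; ring

end circ

end Part2

section Part3

section Bdlemmas

lemma one_add_log_pos {H : ℕ} (hH : 1 ≤ H) : (1 : ℝ) ≤ 1 + Real.log H := by
  have : (1 : ℝ) ≤ H := by exact_mod_cast hH
  linarith [Real.log_nonneg this]

lemma Bd.mono {f g : ℕ → ℕ} {a : ℕ} (hg : Bd g a) (h : ∀ H, 1 ≤ H → f H ≤ g H) : Bd f a := by
  obtain ⟨C, hC, hb⟩ := hg
  refine ⟨C, hC, fun H hH => le_trans ?_ (hb H hH)⟩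
  exact_mod_cast h H hH

lemma Bd.mono_exp {f : ℕ → ℕ} {a b : ℕ} (hf : Bd f a) (h : a ≤ b) : Bd f b := by
  obtain ⟨C, hC, hb⟩ := hf
  refine ⟨C, hC, fun H hH => (hb H hH).trans ?_⟩
  have := one_add_log_pos hH
  have : (1 : ℝ) ≤ H := by exact_mod_cast hH
  gcongr

lemma Bd.sum {α : Type} (s : Finset α) {f : α → ℕ → ℕ} {a : ℕ} (hf : ∀ i ∈ s, Bd (f i) a) :
    Bd (fun H => ∑ i ∈ s, f i H) a := by
  classical
  induction s using Finset.induction_on with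
  | empty =>
    refine ⟨1, one_pos, fun H hH => ?_⟩
    have := one_add_log_pos hH
    simp; positivity
  | insert i s hi ih =>
    obtain ⟨C, hC, hb⟩ := ih fun j hj => hf j (Finset.mem_insert_of_mem hj)
    obtain ⟨C', hC', hb'⟩ := hf i (Finset.mem_insert_self _ _)
    refine ⟨C' + C, by positivity, fun H hH => ?_⟩
    simp only [Finset.sum_insert hi]
    push_cast
    have h1 := hb H hH
    push_cast at h1
    have h2 := hb' H hH
    calc _ ≤ C' * (H : ℝ) ^ a * (1 + Real.log H) + C * (H : ℝ) ^ a * (1 + Real.log H) :=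
          add_le_add h2 h1
      _ = _ := by ring

lemma Bd.mul_pow {f : ℕ → ℕ} {a : ℕ} (hf : Bd f a) (d c e : ℕ) :
    Bd (fun H => d * ((c * H + 1) ^ e * f H)) (e + a) := by
  obtain ⟨C, hC, hb⟩ := hf
  refine ⟨(d + 1) * (c + 1) ^ e * C, by positivity, fun H hH => ?_⟩
  have h1 := one_add_log_pos hH
  have hH1 : (1 : ℝ) ≤ H := by exact_mod_cast hH
  push_cast
  calc (d : ℝ) * ((c * H + 1) ^ e * f H)
      ≤ (d + 1) * (((c + 1) * H) ^ e * (C * (H : ℝ) ^ a * (1 + Real.log H))) := by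
        gcongr
        · linarith
        · nlinarith
        · exact hb H hH
    _ = _ := by rw [_root_.mul_pow, pow_add]; ring

lemma Bd.scale {f : ℕ → ℕ} {a : ℕ} (hf : Bd f a) (c : ℕ) (hc : 1 ≤ c) :
    Bd (fun H => f (c * H)) a := by
  obtain ⟨C, hC, hb⟩ := hf
  have hc1 : (1 : ℝ) ≤ c := by exact_mod_cast hc
  have hlc : 0 ≤ Real.log c := Real.log_nonneg hc1
  refine ⟨C * c ^ a * (1 + Real.log c), by positivity, fun H hH => ?_⟩
  have hH1 : (1 : ℝ) ≤ H := by exact_mod_cast hH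
  have hlH : 0 ≤ Real.log H := Real.log_nonneg hH1
  refine (hb (c * H) (Nat.mul_pos hc hH)).trans ?_
  push_cast
  rw [Real.log_mul (by positivity) (by positivity), _root_.mul_pow]
  calc _ ≤ C * ((c : ℝ) ^ a * H ^ a) * ((1 + Real.log c) * (1 + Real.log H)) := by
        gcongr
        nlinarith [mul_nonneg hlc hlH]
    _ = _ := by ring

end Bdlemmas

section linalg

lemma select_rows {E ι : Type} [AddCommGroup E] [Module ℂ E] [FiniteDimensional ℂ E] [Nonempty ι]
    (φ : ι → E →ₗ[ℂ] ℂ) (K : Submodule ℂ E) (hK : ∀ u ∈ K, ∀ i, φ i u = 0) (q : ℕ) :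
    ∀ U : Submodule ℂ E, K ≤ U → (∀ u ∈ U, (∀ i, φ i u = 0) → u ∈ K) →
      Module.finrank ℂ U ≤ Module.finrank ℂ K + q →
      ∃ J : Fin q → ι, ∀ u ∈ U, (∀ j, φ (J j) u = 0) → u ∈ K := by
  induction q with
  | zero =>
    intro U hKU _ hr
    have := Submodule.eq_of_le_of_finrank_le hKU (by simpa using hr)
    exact ⟨fun j => j.elim0, fun u hu _ => this ▸ hu⟩
  | succ q ih =>
    intro U hKU hU hr
    by_cases hUK : U ≤ K
    · exact ⟨fun _ => Classical.arbitrary ι, fun u hu _ => hUK hu⟩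
    · obtain ⟨u, hu, huK⟩ := Set.not_subset.1 hUK
      have : ∃ i, φ i u ≠ 0 := by
        by_contra h
        push Not at h
        exact huK (hU u hu h)
      obtain ⟨i, hi⟩ := this
      have hlt : U ⊓ LinearMap.ker (φ i) < U := by
        refine lt_of_le_of_ne inf_le_left fun h => hi ?_
        have : u ∈ U ⊓ LinearMap.ker (φ i) := by rw [h]; exact hu
        exact this.2
      have hfr := Submodule.finrank_lt_finrank_of_lt hlt
      obtain ⟨J, hJ⟩ := ih (U ⊓ LinearMap.ker (φ i)) (le_inf hKU fun w hw => hK w hw i)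
        (fun w hw h => hU w hw.1 h) (by omega)
      refine ⟨Fin.cons i J, fun w hw h => hJ w ⟨hw, by simpa using h 0⟩ fun j => ?_⟩
      simpa using h j.succ

lemma perturb {E : Type} [AddCommGroup E] [Module ℂ E] {ρ : ℕ} (b y : Fin ρ → E)
    (hb : LinearIndependent ℂ b) (hy : ∀ j, y j ∈ Submodule.span ℂ (Set.range b)) :
    ∃ t : ℕ, t < ρ + 1 ∧ LinearIndependent ℂ (fun j => y j + (t : ℂ) • b j) := by
  classical
  have : ∀ j, ∃ c : Fin ρ → ℂ, ∑ l, c l • b l = y j := fun j =>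
    (Submodule.mem_span_range_iff_exists_fun ℂ).1 (hy j)
  choose P hP using this
  have hch : ∃ t : ℕ, t < ρ + 1 ∧ (Matrix.of P + Matrix.scalar (Fin ρ) (t : ℂ)).det ≠ 0 := by
    by_contra hcon
    push Not at hcon
    have hmon := (-(Matrix.of P)).charpoly_monic
    have hdeg := (-(Matrix.of P)).charpoly_natDegree_eq_dim
    refine hmon.ne_zero (Polynomial.eq_zero_of_natDegree_lt_card_of_eval_eq_zero' _
      ((Finset.range (ρ + 1)).map ⟨fun t : ℕ => (t : ℂ), Nat.cast_injective⟩) ?_ ?_)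
    · intro z hz
      simp only [Finset.mem_map, Finset.mem_range, Function.Embedding.coeFn_mk] at hz
      obtain ⟨t, ht, rfl⟩ := hz
      rw [Matrix.eval_charpoly, sub_neg_eq_add, add_comm]
      exact hcon t ht
    · rw [hdeg]; simp
  obtain ⟨t, ht, hdet⟩ := hch
  refine ⟨t, ht, ?_⟩
  rw [Fintype.linearIndependent_iff]
  intro c hc
  have h1 : ∑ l, (∑ j, c j * ((Matrix.of P + Matrix.scalar (Fin ρ) (t : ℂ)) j l)) • b l = 0 := by
    rw [← hc]
    simp only [Finset.sum_smul]
    rw [Finset.sum_comm]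
    refine Finset.sum_congr rfl fun j _ => ?_
    rw [← hP j]
    simp only [Matrix.add_apply, Matrix.of_apply, Matrix.scalar_apply, Matrix.diagonal_apply,
      smul_add, Finset.smul_sum, mul_add, add_smul, Finset.sum_add_distrib, mul_smul]
    congr 1
    rw [Finset.sum_eq_single j]
    · simp
    · intro l _ hl; simp [hl.symm]
    · simp
  have h2 := Fintype.linearIndependent_iff.1 hb _ h1
  have h3 : c ᵥ* (Matrix.of P + Matrix.scalar (Fin ρ) (t : ℂ)) = 0 := by
    ext l; simpa [vecMul, dotProduct] using h2 l
  have := Matrix.eq_zero_of_vecMul_eq_zero hdet h3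
  exact fun i => congrFun this i

end linalg

section Tpart
variable {κ : Type} [Fintype κ]

/-- cast to complex vectors -/
def cc (x : κ → ℤ) : κ → ℂ := fun j => (x j : ℂ)

open Classical in
noncomputable def Tset (κ : Type) [Fintype κ] (ρ H : ℕ) : Finset ((Fin ρ → κ → ℤ) × (κ → ℤ)) :=
  (mbox (Fin ρ) κ H ×ˢ zbox κ H).filter fun p => LinearIndependent ℂ (fun j => cc (p.1 j)) ∧
    cc p.2 ∈ Submodule.span ℂ (Set.range fun j => cc (p.1 j))

lemma mem_Tset {ρ H : ℕ} {p : (Fin ρ → κ → ℤ) × (κ → ℤ)} : p ∈ Tset κ ρ H ↔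
    (p.1 ∈ mbox (Fin ρ) κ H ∧ p.2 ∈ zbox κ H) ∧ LinearIndependent ℂ (fun j => cc (p.1 j)) ∧
    cc p.2 ∈ Submodule.span ℂ (Set.range fun j => cc (p.1 j)) := by
  classical
  rw [Tset, Finset.mem_filter, Finset.mem_product]

lemma rational_span {ρ : ℕ} (b : Fin ρ → κ → ℤ) (x : κ → ℤ)
    (hx : cc x ∈ Submodule.span ℂ (Set.range fun j => cc (b j))) :
    ∃ c : Fin ρ → ℚ, ∀ i, (x i : ℚ) = ∑ j, c j * b j i := by
  obtain ⟨c, hc⟩ := (Submodule.mem_span_range_iff_exists_fun ℂ).1 hx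
  obtain ⟨l, hl⟩ : ∃ l : ℂ →ₗ[ℚ] ℚ, l 1 = 1 := by
    have h : ¬ ∀ f : Module.Dual ℚ ℂ, f 1 = 0 := by
      rw [Module.forall_dual_apply_eq_zero_iff]; exact one_ne_zero
    push Not at h
    obtain ⟨f, hf⟩ := h
    exact ⟨(f 1)⁻¹ • f, by simp [hf]⟩
  refine ⟨fun j => l (c j), fun i => ?_⟩
  have h1 := congrArg l (congrFun hc i)
  simp only [Finset.sum_apply, Pi.smul_apply, cc, smul_eq_mul, map_sum] at h1
  have h2 : ∀ (z : ℂ) (a : ℤ), l (z * a) = l z * a := by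
    intro z a
    have : z * (a : ℂ) = (a : ℚ) • z := by
      rw [Rat.smul_def]; push_cast; ring
    rw [this, map_smul, smul_eq_mul, mul_comm]
  have h3 : l (x i : ℂ) = x i := by
    have := h2 1 (x i)
    rwa [one_mul, hl, one_mul] at this
  rw [h3] at h1
  rw [← h1]
  exact Finset.sum_congr rfl fun j _ => h2 _ _

lemma Tset_bound (ρ : ℕ) (hρ : ρ + 1 ≤ Fintype.card κ) :
    Bd (fun H => (Tset κ ρ H).card) (Fintype.card κ * ρ) := by
  have h := circ_bound (ι := κ) (κ := Option (Fin ρ)) (by simp) (by simpa using hρ)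
  simp only [Fintype.card_option, Fintype.card_fin, Nat.add_sub_cancel] at h
  refine h.mono fun H hH => ?_
  refine Finset.card_le_card_of_injOn
    (fun p => fun i o => o.elim (p.2 i) (fun j => p.1 j i)) ?_ ?_
  · rintro ⟨b, x⟩ hp
    rw [Finset.mem_coe, mem_Tset] at hp
    obtain ⟨⟨hb, hx⟩, hli, hsp⟩ := hp
    rw [Finset.mem_coe, mem_circ]
    refine ⟨?_, ?_⟩
    · rw [mem_mbox]
      intro i
      rw [mem_zbox]
      rintro (_ | j)
      · exact mem_zbox.1 hx i
      · exact mem_zbox.1 (mem_mbox.1 hb j) i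
    · obtain ⟨c, hc⟩ := rational_span b x hsp
      obtain ⟨⟨N, hN⟩, hNc⟩ := IsLocalization.exist_integer_multiples_of_finite
        (nonZeroDivisors ℤ) c
      have hN0 : N ≠ 0 := nonZeroDivisors.ne_zero hN
      choose w hw using hNc
      have hw' : ∀ j, (w j : ℚ) = N * c j := by
        intro j; have := hw j; simpa using this
      refine ⟨fun o => o.elim (-N) w, ?_, ?_, ?_⟩
      · intro h
        have := congrFun h none
        simp at this
        exact hN0 this
      · intro i
        simp only [dotProduct, Fintype.sum_option, Option.elim]
        have : ((x i * -N + ∑ j, b j i * w j : ℤ) : ℚ) = 0 := by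
          push_cast
          simp only [hw', hc i, Finset.sum_mul, ← Finset.sum_add_distrib]
          exact Finset.sum_eq_zero fun j _ => by ring
        exact_mod_cast this
      · intro u hu
        have hNq : (N : ℚ) ≠ 0 := by exact_mod_cast hN0
        refine ⟨-(u none) / N, ?_⟩
        have key : ∀ j, u (some j) + u none * c j = 0 := by
          have h0 : ∀ i, ∑ j, (u (some j) + u none * c j) * (b j i : ℚ) = 0 := by
            intro i
            have := hu i
            simp only [Fintype.sum_option, Option.elim, hc i] at this
            rw [← this, Finset.sum_mul, ← Finset.sum_add_distrib]
            exact Finset.sum_congr rfl fun j _ => by ring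
          have h1 := Fintype.linearIndependent_iff.1 hli
            (fun j => ((u (some j) + u none * c j : ℚ) : ℂ)) (by
              ext i
              simp only [Finset.sum_apply, Pi.smul_apply, cc, smul_eq_mul, Pi.zero_apply]
              have := congrArg (fun q : ℚ => (q : ℂ)) (h0 i)
              push_cast at this ⊢
              exact this)
          intro j
          exact_mod_cast h1 j
        rintro (_ | j)
        · simp only [Option.elim]; push_cast; field_simp
        · simp only [Option.elim, hw']
          have := key j
          field_simp
          linarith
  · rintro ⟨b, x⟩ _ ⟨b', x'⟩ _ h
    have h1 : ∀ i o, _ := fun i o => congrFun (congrFun h i) o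
    ext i j
    · exact h1 j (some i)
    · exact h1 _ none

end Tpart

end Part3

section Part4

section mainstep
variable {ι κ : Type} [Fintype ι] [Fintype κ]

/-- kernel of `B - D` -/
noncomputable def kerB (D : ι → κ → ℂ) (B : ι → κ → ℤ) : Submodule ℂ (κ → ℂ) :=
  LinearMap.ker (Matrix.mulVecLin (Matrix.of fun i => cc (B i) - D i))

lemma mem_kerB {D : ι → κ → ℂ} {B : ι → κ → ℤ} {u : κ → ℂ} :
    u ∈ kerB D B ↔ ∀ i, (cc (B i) - D i) ⬝ᵥ u = 0 := by
  rw [kerB, LinearMap.mem_ker, funext_iff]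
  rfl

open Classical in
noncomputable def Bset (D : ι → κ → ℂ) (H : ℕ) : Finset (ι → κ → ℤ) :=
  (mbox ι κ H).filter fun B => Module.finrank ℂ (kerB D B) = 1

lemma mem_Bset {D : ι → κ → ℂ} {H : ℕ} {B : ι → κ → ℤ} :
    B ∈ Bset D H ↔ B ∈ mbox ι κ H ∧ Module.finrank ℂ (kerB D B) = 1 := by
  classical
  rw [Bset, Finset.mem_filter]

open Classical in
noncomputable def Xset (K : Submodule ℂ (κ → ℂ)) (H : ℕ) : Finset (κ → ℤ) :=
  (zbox κ (2 * H)).filter fun x => ∀ u ∈ K, cc x ⬝ᵥ u = 0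

lemma mem_Xset {K : Submodule ℂ (κ → ℂ)} {H : ℕ} {x : κ → ℤ} :
    x ∈ Xset K H ↔ x ∈ zbox κ (2 * H) ∧ ∀ u ∈ K, cc x ⬝ᵥ u = 0 := by
  classical
  rw [Xset, Finset.mem_filter]


lemma cc_add (x y : κ → ℤ) : cc (x + y) = cc x + cc y := by
  ext j; simp [cc]

lemma cc_sub (x y : κ → ℤ) : cc (x - y) = cc x - cc y := by
  ext j; simp [cc]

lemma cc_nsmul (t : ℕ) (y : κ → ℤ) : cc (t • y) = (t : ℂ) • cc y := by
  ext j; simp [cc]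

lemma fiber_bound [DecidableEq (Submodule ℂ (κ → ℂ))] (D : ι → κ → ℂ) (H : ℕ)
    (K : Submodule ℂ (κ → ℂ)) :
    ((Bset D H).filter fun B => kerB D B = K).card ≤ (Xset K H).card ^ Fintype.card ι := by
  classical
  rcases ((Bset D H).filter fun B => kerB D B = K).eq_empty_or_nonempty with h | ⟨B0, h0⟩
  · rw [h]; simp
  · have : (Xset K H).card ^ Fintype.card ι =
        (Fintype.piFinset fun _ : ι => Xset K H).card := by simp [Fintype.card_piFinset]
    rw [this]
    refine Finset.card_le_card_of_injOn (fun B => B - B0) ?_ ?_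
    · intro B hB
      rw [Finset.mem_filter, mem_Bset] at h0
      rw [Finset.mem_coe, Finset.mem_filter, mem_Bset] at hB
      rw [Finset.mem_coe, Fintype.mem_piFinset]
      intro i
      rw [mem_Xset]
      refine ⟨?_, fun u hu => ?_⟩
      · rw [mem_zbox]
        intro j
        have h1 := mem_zbox.1 (mem_mbox.1 h0.1.1 i) j
        have h2 := mem_zbox.1 (mem_mbox.1 hB.1.1 i) j
        rw [abs_le] at *
        simp only [Pi.sub_apply]
        push_cast
        constructor <;> linarith
      · have h1 := mem_kerB.1 (h0.2 ▸ hu) i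
        have h2 := mem_kerB.1 (hB.2 ▸ hu) i
        change cc (B i - B0 i) ⬝ᵥ u = 0
        rw [cc_sub, sub_dotProduct]
        rw [sub_dotProduct] at h1 h2
        linear_combination h2 - h1
    · intro B _ B' _ h
      exact sub_left_injective h

lemma Xset_card_le (K : Submodule ℂ (κ → ℂ)) (hK : K ≠ ⊥) (H : ℕ) :
    (Xset K H).card ≤ (4 * H + 1) ^ (Fintype.card κ - 1) := by
  classical
  obtain ⟨u, hu, hu0⟩ := Submodule.exists_mem_ne_zero_of_ne_bot hK
  obtain ⟨j0, hj0⟩ := Function.ne_iff.1 hu0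
  have hcard : Fintype.card {j : κ // j ≠ j0} = Fintype.card κ - 1 := by
    simp [Fintype.card_subtype_compl]
  have h4 : 4 * H + 1 = 2 * (2 * H) + 1 := by ring
  rw [← hcard, h4, ← card_zbox]
  refine Finset.card_le_card_of_injOn (fun x => fun j => x j.1) ?_ ?_
  · intro x hx
    rw [Finset.mem_coe, mem_Xset] at hx
    rw [Finset.mem_coe, mem_zbox]
    exact fun j => mem_zbox.1 hx.1 j.1
  · intro x hx y hy h
    rw [Finset.mem_coe, mem_Xset] at hx hy
    have hj : ∀ j, j ≠ j0 → x j = y j := fun j hj => congrFun h ⟨j, hj⟩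
    have h1 : cc (x - y) ⬝ᵥ u = 0 := by
      rw [cc_sub, sub_dotProduct, hx.2 u hu, hy.2 u hu, sub_zero]
    rw [dotProduct, Finset.sum_eq_single j0] at h1
    · have h2 := (mul_eq_zero.1 h1).resolve_right hj0
      have h3 : x j0 - y j0 = 0 := by
        have h4 : ((x j0 - y j0 : ℤ) : ℂ) = 0 := h2
        exact_mod_cast h4
      ext j
      by_cases hjj : j = j0
      · subst hjj; linarith
      · exact hj j hjj
    · intro j _ hjj
      simp [cc, hj j hjj]
    · simp

lemma dot_span {S : Set (κ → ℂ)} {u x : κ → ℂ} (hx : x ∈ Submodule.span ℂ S)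
    (h : ∀ s ∈ S, s ⬝ᵥ u = 0) : x ⬝ᵥ u = 0 := by
  induction hx using Submodule.span_induction with
  | mem s hs => exact h s hs
  | zero => simp
  | add x y _ _ hx hy => rw [add_dotProduct, hx, hy, add_zero]
  | smul a x _ hx => rw [smul_dotProduct, hx, smul_zero]

/-- combinatorial data attached to a kernel line -/
structure Good (D : ι → κ → ℂ) (H ρ q : ℕ) (J : Fin q → ι) (K : Submodule ℂ (κ → ℂ))
    (b : Fin ρ → κ → ℤ) (B : ι → κ → ℤ) : Prop where
  hB : B ∈ mbox ι κ H
  hBK : ∀ u ∈ K, ∀ i, (cc (B i) - D i) ⬝ᵥ u = 0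
  hb : ∀ j, b j ∈ Xset K H
  hli : LinearIndependent ℂ fun j => cc (b j)
  hsp : ∀ x ∈ Xset K H, cc x ∈ Submodule.span ℂ (Set.range fun j => cc (b j))
  hJ : ∀ u, (∀ j, cc (b j) ⬝ᵥ u = 0) → (∀ j, (cc (B (J j)) - D (J j)) ⬝ᵥ u = 0) → u ∈ K

lemma exists_good [Nonempty ι] (D : ι → κ → ℂ) (H : ℕ) (B : ι → κ → ℤ) (hB : B ∈ Bset D H) :
    ∃ ρ, ρ < Fintype.card κ ∧ ∃ J : Fin (Fintype.card κ - 1 - ρ) → ι, ∃ b,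
      Good D H ρ _ J (kerB D B) b B := by
  classical
  obtain ⟨hB1, hB2⟩ := mem_Bset.1 hB
  set K := kerB D B
  obtain ⟨ρ, f, hf1, hf2, hf3⟩ : ∃ ρ : ℕ, ∃ f : Fin ρ → κ → ℂ,
      (∀ i, f i ∈ cc '' (Xset K H : Set (κ → ℤ))) ∧
      Submodule.span ℂ (Set.range f) = Submodule.span ℂ (cc '' (Xset K H : Set (κ → ℤ))) ∧
      LinearIndependent ℂ f :=
    ⟨_, Submodule.exists_fun_fin_finrank_span_eq ℂ (cc '' (Xset K H : Set (κ → ℤ)))⟩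
  choose b hb1 hb2 using hf1
  have hbf : (fun j => cc (b j)) = f := _root_.funext hb2
  set G : Matrix (Fin ρ) κ ℂ := Matrix.of f
  have hrank : G.rank = ρ := by
    have : LinearIndependent ℂ G.row := hf3
    simpa using this.rank_matrix
  have hnul := LinearMap.finrank_range_add_finrank_ker G.mulVecLin
  have hr' : Module.finrank ℂ (LinearMap.range G.mulVecLin) = ρ := hrank
  rw [hr', Module.finrank_fintype_fun_eq_card] at hnul
  have hmem : ∀ u, u ∈ LinearMap.ker G.mulVecLin ↔ ∀ j, cc (b j) ⬝ᵥ u = 0 := by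
    intro u
    rw [LinearMap.mem_ker, funext_iff]
    refine forall_congr' fun j => ?_
    rw [hb2 j]; rfl
  have hKU : K ≤ LinearMap.ker G.mulVecLin := by
    intro u hu
    rw [hmem]
    intro j
    exact (mem_Xset.1 (hb1 j)).2 u hu
  have hle := Submodule.finrank_mono hKU
  have hBK : ∀ u ∈ K, ∀ i, (cc (B i) - D i) ⬝ᵥ u = 0 := fun u hu => mem_kerB.1 hu
  let φ : ι → (κ → ℂ) →ₗ[ℂ] ℂ := fun i => dotProductBilin ℂ ℂ (cc (B i) - D i)
  obtain ⟨J, hJ⟩ := select_rows φ K (fun u hu i => hBK u hu i) (Fintype.card κ - 1 - ρ)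
    (LinearMap.ker G.mulVecLin) hKU (fun u _ h => mem_kerB.2 h) (by omega)
  refine ⟨ρ, by omega, J, b, hB1, hBK, hb1, hbf ▸ hf3, ?_, ?_⟩
  · intro x hx
    rw [hbf, hf2]
    exact Submodule.subset_span ⟨x, hx, rfl⟩
  · intro u h1 h2
    exact hJ u ((hmem u).2 h1) h2

lemma Good.char {D : ι → κ → ℂ} {H ρ q : ℕ} {J : Fin q → ι} {K : Submodule ℂ (κ → ℂ)}
    {b : Fin ρ → κ → ℤ} {B : ι → κ → ℤ} (hG : Good D H ρ q J K b B) {b' : Fin ρ → κ → ℤ}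
    (hb' : ∀ j, ∃ y ∈ Xset K H, ∃ t : ℕ, b' j = y + t • b j)
    (hli : LinearIndependent ℂ fun j => cc (b' j)) :
    Submodule.span ℂ (Set.range fun j => cc (b' j)) =
      Submodule.span ℂ (Set.range fun j => cc (b j)) := by
  refine Submodule.eq_of_le_of_finrank_le ?_ ?_
  · rw [Submodule.span_le]
    rintro _ ⟨j, rfl⟩
    obtain ⟨y, hy, t, ht⟩ := hb' j
    simp only [ht, cc_add, cc_nsmul]
    exact Submodule.add_mem _ (hG.hsp y hy)
      (Submodule.smul_mem _ _ (Submodule.subset_span ⟨j, rfl⟩))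
  · rw [finrank_span_eq_card hli, finrank_span_eq_card hG.hli]

lemma Good.char2 {D : ι → κ → ℂ} {H ρ q : ℕ} {J : Fin q → ι} {K : Submodule ℂ (κ → ℂ)}
    {b : Fin ρ → κ → ℤ} {B : ι → κ → ℤ} (hG : Good D H ρ q J K b B) {b' : Fin ρ → κ → ℤ}
    (hb' : ∀ j, ∃ y ∈ Xset K H, ∃ t : ℕ, b' j = y + t • b j)
    (hli : LinearIndependent ℂ fun j => cc (b' j))
    {g r : Fin q → κ → ℤ} (hg : ∀ j, g j ∈ Xset K H) (hr : ∀ j, r j = B (J j) + g j) (u : κ → ℂ) :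
    u ∈ K ↔ (∀ j, cc (b' j) ⬝ᵥ u = 0) ∧ ∀ j, (cc (r j) - D (J j)) ⬝ᵥ u = 0 := by
  have hsp := hG.char hb' hli
  constructor
  · intro hu
    refine ⟨fun j => ?_, fun j => ?_⟩
    · obtain ⟨y, hy, t, ht⟩ := hb' j
      rw [ht, cc_add, cc_nsmul, add_dotProduct, smul_dotProduct, (mem_Xset.1 hy).2 u hu,
        (mem_Xset.1 (hG.hb j)).2 u hu]
      simp
    · have h1 := hG.hBK u hu (J j)
      have h2 := (mem_Xset.1 (hg j)).2 u hu
      rw [hr, cc_add, sub_dotProduct, add_dotProduct, h2]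
      rw [sub_dotProduct] at h1
      linear_combination h1
  · rintro ⟨h1, h2⟩
    have hall : ∀ x, x ∈ Submodule.span ℂ (Set.range fun j => cc (b j)) → x ⬝ᵥ u = 0 := by
      intro x hx
      rw [← hsp] at hx
      refine dot_span hx ?_
      rintro _ ⟨j, rfl⟩
      exact h1 j
    refine hG.hJ u (fun j => hall _ (Submodule.subset_span ⟨j, rfl⟩)) fun j => ?_
    have h3 := hall _ (hG.hsp _ (hg j))
    have h4 := h2 j
    rw [hr, cc_add, sub_dotProduct, add_dotProduct, h3] at h4
    rw [sub_dotProduct]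
    linear_combination h4

lemma sum_good_bound (D : ι → κ → ℂ) (H ρ q : ℕ) (J : Fin q → ι)
    (S : Finset (Submodule ℂ (κ → ℂ))) (hS : ∀ K ∈ S, ∃ b B, Good D H ρ q J K b B) :
    ∑ K ∈ S, (Xset K H).card ^ (ρ + q + 1) ≤
      (ρ + 1) * ((6 * H + 1) ^ (q * Fintype.card κ) * (Tset κ ρ (2 * (ρ + 1) * H)).card) := by
  classical
  choose! b B hG using hS
  have ht : ∀ K ∈ S, ∀ y : Fin ρ → κ → ℤ, (∀ j, y j ∈ Xset K H) → ∃ t : ℕ, t < ρ + 1 ∧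
      LinearIndependent ℂ (fun j => cc (y j + t • b K j)) := by
    intro K hK y hy
    obtain ⟨t, h1, h2⟩ := perturb (fun j => cc (b K j)) (fun j => cc (y j)) (hG K hK).hli
      (fun j => (hG K hK).hsp _ (hy j))
    refine ⟨t, h1, ?_⟩
    simpa only [cc_add, cc_nsmul] using h2
  choose! t ht1 ht2 using ht
  let P : Submodule ℂ (κ → ℂ) → Finset ((Fin ρ → κ → ℤ) × (κ → ℤ) × (Fin q → κ → ℤ)) := fun K =>
    (Fintype.piFinset fun _ => Xset K H) ×ˢ (Xset K H) ×ˢ (Fintype.piFinset fun _ => Xset K H)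
  have hP : ∀ K, (P K).card = (Xset K H).card ^ (ρ + q + 1) := by
    intro K
    simp only [P, Finset.card_product, Fintype.card_piFinset, Finset.prod_const, Finset.card_univ,
      Fintype.card_fin]
    ring
  have hR : (ρ + 1) * ((6 * H + 1) ^ (q * Fintype.card κ) * (Tset κ ρ (2 * (ρ + 1) * H)).card) =
      (Finset.range (ρ + 1) ×ˢ (mbox (Fin q) κ (3 * H) ×ˢ Tset κ ρ (2 * (ρ + 1) * H))).card := by
    rw [Finset.card_product, Finset.card_product, card_mbox, Finset.card_range, Fintype.card_fin]
    congr 4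
    ring
  simp only [← hP]
  rw [← Finset.card_sigma, hR]
  refine Finset.card_le_card_of_injOn (fun p => (t p.1 p.2.1, (fun j => B p.1 (J j) + p.2.2.2 j,
    (fun j => p.2.1 j + t p.1 p.2.1 • b p.1 j, p.2.2.1)))) ?_ ?_
  · rintro ⟨K, y, x, g⟩ hp
    simp only [Finset.coe_sigma, Set.mem_sigma_iff, Finset.mem_coe, P, Finset.mem_product,
      Fintype.mem_piFinset] at hp
    obtain ⟨hK, hy, hx, hg⟩ := hp
    have hGK := hG K hK
    have htK := ht1 K hK y hy
    simp only [Finset.mem_coe, Finset.mem_product, Finset.mem_range, mem_Tset, mem_mbox]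
    refine ⟨htK, fun j => ?_, ⟨fun j => ?_, ?_⟩, ht2 K hK y hy, ?_⟩
    · rw [mem_zbox]
      intro i
      have h1 := mem_zbox.1 (mem_mbox.1 hGK.hB (J j)) i
      have h2 := mem_zbox.1 (mem_Xset.1 (hg j)).1 i
      refine (abs_add_le _ _).trans ?_
      push_cast at *
      linarith
    · rw [mem_zbox]
      intro i
      have h1 := mem_zbox.1 (mem_Xset.1 (hGK.hb j)).1 i
      have h2 := mem_zbox.1 (mem_Xset.1 (hy j)).1 i
      refine (abs_add_le _ _).trans ?_
      have h3 : |(t K y • b K j) i| ≤ ρ * (2 * H : ℕ) := by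
        simp only [Pi.smul_apply, nsmul_eq_mul, abs_mul, Nat.abs_cast]
        have : (t K y : ℤ) ≤ ρ := by exact_mod_cast Nat.lt_succ_iff.1 htK
        gcongr
      push_cast at *
      linarith
    · rw [mem_zbox]
      intro i
      have h2 := mem_zbox.1 (mem_Xset.1 hx).1 i
      refine h2.trans ?_
      have : (0 : ℤ) ≤ ρ * H := by positivity
      push_cast
      linarith
    · rw [hGK.char (fun j => ⟨y j, hy j, t K y, rfl⟩) (ht2 K hK y hy)]
      exact hGK.hsp x hx
  · rintro ⟨K, y, x, g⟩ hp ⟨K', y', x', g'⟩ hp' heq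
    simp only [Finset.coe_sigma, Set.mem_sigma_iff, Finset.mem_coe, P, Finset.mem_product,
      Fintype.mem_piFinset] at hp hp'
    obtain ⟨hK, hy, hx, hg⟩ := hp
    obtain ⟨hK', hy', hx', hg'⟩ := hp'
    simp only [Prod.mk.injEq] at heq
    obtain ⟨e1, e2, e3, e4⟩ := heq
    have c1 := (hG K hK).char2 (fun j => ⟨y j, hy j, t K y, rfl⟩) (ht2 K hK y hy) hg
      (r := fun j => B K (J j) + g j) (fun j => rfl)
    have c2 := (hG K' hK').char2 (fun j => ⟨y' j, hy' j, t K' y', rfl⟩) (ht2 K' hK' y' hy') hg'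
      (r := fun j => B K' (J j) + g' j) (fun j => rfl)
    have hKK : K = K' := by
      ext u
      rw [c1, c2]
      have e3' := fun j => congrFun e3 j
      have e2' := fun j => congrFun e2 j
      simp only [e3', e2']
    subst hKK
    have hgg : g = g' := by
      funext j
      exact add_left_cancel (congrFun e2 j)
    have hyy : y = y' := by
      funext j
      have := congrFun e3 j
      rw [e1] at this
      exact add_right_cancel this
    subst hgg hyy e4
    rfl

lemma Bset_bound (D : ι → κ → ℂ) (hk : 1 ≤ Fintype.card κ)
    (hkn : Fintype.card κ ≤ Fintype.card ι) :
    Bd (fun H => (Bset D H).card) (Fintype.card ι * (Fintype.card κ - 1)) := by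
  classical
  set k := Fintype.card κ
  set n := Fintype.card ι
  have : Nonempty ι := Fintype.card_pos_iff.1 (by omega)
  let Idx := Σ ρ : Fin k, (Fin (k - 1 - ρ) → ι)
  have key : Bd (fun H => 1 * ((4 * H + 1) ^ ((k - 1) * (n - k)) * ∑ p : Idx,
      ((p.1 : ℕ) + 1) * ((6 * H + 1) ^ ((k - 1 - p.1) * k) *
        (Tset κ p.1 (2 * ((p.1 : ℕ) + 1) * H)).card)))
      ((k - 1) * (n - k) + (k - 1) * k) := by
    refine Bd.mul_pow (Bd.sum _ fun p _ => ?_) _ _ _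
    have h1 := ((Tset_bound (κ := κ) p.1 p.1.2).scale (2 * ((p.1 : ℕ) + 1)) (by omega)).mul_pow
      (p.1 + 1) 6 ((k - 1 - p.1) * k)
    refine h1.mono_exp (le_of_eq ?_)
    have := p.1.2
    rw [mul_comm (Fintype.card κ), ← add_mul]
    congr 1
    omega
  refine (key.mono fun H hH => ?_).mono_exp (le_of_eq ?_)
  · rw [one_mul]
    let S := (Bset D H).image (kerB D)
    have h1 : (Bset D H).card = ∑ K ∈ S, ((Bset D H).filter fun B => kerB D B = K).card :=
      Finset.card_eq_sum_card_image _ _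
    have h2 : ∀ K ∈ S, ((Bset D H).filter fun B => kerB D B = K).card ≤
        (4 * H + 1) ^ ((k - 1) * (n - k)) * (Xset K H).card ^ k := by
      intro K hK
      obtain ⟨B, hB, rfl⟩ := Finset.mem_image.1 hK
      refine (fiber_bound D H _).trans ?_
      have hne : kerB D B ≠ ⊥ := by
        intro h
        have := (mem_Bset.1 hB).2
        rw [h] at this
        simp at this
      calc (Xset (kerB D B) H).card ^ n
          = (Xset (kerB D B) H).card ^ (n - k) * (Xset (kerB D B) H).card ^ k := by
            rw [← pow_add]; congr 1; omega
        _ ≤ ((4 * H + 1) ^ (k - 1)) ^ (n - k) * (Xset (kerB D B) H).card ^ k := by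
            gcongr
            exact Xset_card_le _ hne H
        _ = _ := by rw [← pow_mul]
    rw [h1]
    refine (Finset.sum_le_sum h2).trans ?_
    rw [← Finset.mul_sum]
    gcongr
    let Sp : Idx → Finset (Submodule ℂ (κ → ℂ)) := fun p =>
      S.filter fun K => ∃ b B, Good D H p.1 _ p.2 K b B
    have hcov : ∀ K ∈ S, ∃ p : Idx, ∃ b B, Good D H p.1 _ p.2 K b B := by
      intro K hK
      obtain ⟨B, hB, rfl⟩ := Finset.mem_image.1 hK
      obtain ⟨ρ, hρ, J, b, hg⟩ := exists_good D H B hB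
      exact ⟨⟨⟨ρ, hρ⟩, J⟩, b, B, hg⟩
    calc ∑ K ∈ S, (Xset K H).card ^ k
        ≤ ∑ p, ∑ K ∈ Sp p, (Xset K H).card ^ k := by
          simp only [Sp, Finset.sum_filter]
          rw [Finset.sum_comm]
          refine Finset.sum_le_sum fun K hK => ?_
          obtain ⟨p, hp⟩ := hcov K hK
          refine le_trans (le_of_eq ?_)
            (Finset.single_le_sum (fun _ _ => Nat.zero_le _) (Finset.mem_univ p))
          rw [if_pos hp]
      _ ≤ _ := by
        refine Finset.sum_le_sum fun p _ => ?_
        have := sum_good_bound D H p.1 _ p.2 (Sp p) (fun K hK => (Finset.mem_filter.1 hK).2)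
        have hp := p.1.2
        have he : (p.1 : ℕ) + (k - 1 - p.1) + 1 = k := by omega
        rwa [he] at this
  · rw [← mul_add, mul_comm]
    congr 1
    omega

end mainstep

end Part4


open Classical in
noncomputable def Sing {n : ℕ} (D : Fin n → Fin n → ℂ) (H : ℕ) : Finset (Fin n → Fin n → ℤ) :=
  (mbox (Fin n) (Fin n) H).filter fun A => kerB D A ≠ ⊥

lemma mem_Sing {n : ℕ} {D : Fin n → Fin n → ℂ} {H : ℕ} {A : Fin n → Fin n → ℤ} :
    A ∈ Sing D H ↔ A ∈ mbox (Fin n) (Fin n) H ∧ kerB D A ≠ ⊥ := by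
  classical
  rw [Sing, Finset.mem_filter]

lemma sum_subtype_ext {n : ℕ} (S : Finset (Fin n)) (a : Fin n → ℂ) (w : S → ℂ) :
    a ⬝ᵥ (fun j => if h : j ∈ S then w ⟨j, h⟩ else 0) = (fun j : S => a j) ⬝ᵥ w := by
  classical
  simp only [dotProduct]
  rw [← Finset.sum_subset (Finset.subset_univ S), ← Finset.sum_coe_sort S]
  · refine Finset.sum_congr rfl fun j _ => ?_
    simp
  · intro j _ hj
    simp [hj]

lemma exists_support {n : ℕ} (D : Fin n → Fin n → ℂ) (A : Fin n → Fin n → ℤ)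
    (hA : kerB D A ≠ ⊥) : ∃ S : Finset (Fin n), S.Nonempty ∧
      Module.finrank ℂ (kerB (κ := S) (fun i j => D i j) (fun i j => A i j)) = 1 := by
  classical
  let supp : (Fin n → ℂ) → Finset (Fin n) := fun u => Finset.univ.filter fun j => u j ≠ 0
  have hex : ∃ m : ℕ, ∃ u ∈ kerB D A, u ≠ 0 ∧ (supp u).card = m := by
    obtain ⟨u, hu, hu0⟩ := Submodule.exists_mem_ne_zero_of_ne_bot hA
    exact ⟨_, u, hu, hu0, rfl⟩
  obtain ⟨u, hu, hu0, hum⟩ := Nat.find_spec hex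
  have hmin : ∀ w ∈ kerB D A, (supp w).card < (supp u).card → w = 0 := by
    intro w hw hlt
    by_contra hne
    rw [hum] at hlt
    exact Nat.find_min hex hlt ⟨w, hw, hne, rfl⟩
  obtain ⟨j0, hj0⟩ := Function.ne_iff.1 hu0
  have hj0S : j0 ∈ supp u := by simpa [supp] using hj0
  have hj0' : u j0 ≠ 0 := hj0
  refine ⟨supp u, ⟨j0, hj0S⟩, ?_⟩
  have hmem : ∀ w : supp u → ℂ, w ∈ kerB (κ := supp u) (fun i j => D i j) (fun i j => A i j) ↔
      (fun j => if h : j ∈ supp u then w ⟨j, h⟩ else 0) ∈ kerB D A := by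
    intro w
    rw [mem_kerB, mem_kerB]
    refine forall_congr' fun i => ?_
    rw [sum_subtype_ext]
    rfl
  have hu_ext : (fun j => if h : j ∈ supp u then (fun l : supp u => u l) ⟨j, h⟩ else 0) = u := by
    ext j
    by_cases h : j ∈ supp u
    · simp [h]
    · have : u j = 0 := by simpa [supp] using h
      simp [h, this]
  rw [finrank_eq_one_iff']
  refine ⟨⟨fun l => u l, (hmem _).2 (by rw [hu_ext]; exact hu)⟩, ?_, ?_⟩
  · intro h
    have := congrFun (congrArg Subtype.val h) ⟨j0, hj0S⟩
    exact hj0' this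
  · rintro ⟨w, hw⟩
    have hw' := (hmem w).1 hw
    set W : Fin n → ℂ := fun j => if h : j ∈ supp u then w ⟨j, h⟩ else 0 with hW
    have hz : W - (W j0 / u j0) • u = 0 := by
      refine hmin _ (Submodule.sub_mem _ hw' (Submodule.smul_mem _ _ hu)) ?_
      refine Finset.card_lt_card ⟨?_, ?_⟩
      · intro j hj
        by_contra hjn
        have h0 : u j = 0 := by simpa [supp] using hjn
        have h1 : W j = 0 := by simp only [hW]; rw [dif_neg hjn]
        simp [supp, h0, h1] at hj
      · intro hsub
        have := hsub hj0S
        simp [supp, hj0'] at this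
    refine ⟨W j0 / u j0, ?_⟩
    ext l
    have h1 := congrFun hz l.1
    have h2 : W l.1 = w l := by simp only [hW]; rw [dif_pos l.2]
    simp only [Pi.sub_apply, Pi.smul_apply, smul_eq_mul, Pi.zero_apply, h2] at h1
    simp only [SetLike.mk_smul_mk, Pi.smul_apply, smul_eq_mul]
    linear_combination -h1

lemma Sing_bound {n : ℕ} (hn : 1 ≤ n) (D : Fin n → Fin n → ℂ) :
    Bd (fun H => (Sing D H).card) (n * (n - 1)) := by
  classical
  have key : Bd (fun H => ∑ S ∈ (Finset.univ : Finset (Finset (Fin n))).filter (·.Nonempty),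
      1 * ((2 * H + 1) ^ (n * (n - S.card)) *
        (Bset (κ := S) (fun i j => D i j) H).card)) (n * (n - 1)) := by
    refine Bd.sum _ fun S hS => ?_
    have hS1 : 1 ≤ S.card := Finset.card_pos.2 (Finset.mem_filter.1 hS).2
    have hS2 : S.card ≤ n := by simpa using Finset.card_le_univ S
    have h1 := Bset_bound (ι := Fin n) (κ := S) (fun i j => D i j) (by simpa using hS1)
      (by simpa using hS2)
    refine (h1.mul_pow 1 2 (n * (n - S.card))).mono_exp (le_of_eq ?_)
    simp only [Fintype.card_fin, Fintype.card_coe]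
    rw [← mul_add]
    congr 1
    omega
  refine key.mono fun H hH => ?_
  let E : Finset (Fin n) → Finset (Fin n → Fin n → ℤ) := fun S => (Sing D H).filter fun A =>
    Module.finrank ℂ (kerB (κ := S) (fun i j => D i j) (fun i j => A i j)) = 1
  have hsub : Sing D H ⊆ ((Finset.univ : Finset (Finset (Fin n))).filter (·.Nonempty)).biUnion E := by
    intro A hA
    obtain ⟨S, hS, hf⟩ := exists_support D A (mem_Sing.1 hA).2
    rw [Finset.mem_biUnion]
    exact ⟨S, by simpa using hS, Finset.mem_filter.2 ⟨hA, hf⟩⟩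
  refine (Finset.card_le_card hsub).trans (Finset.card_biUnion_le.trans ?_)
  refine Finset.sum_le_sum fun S _ => ?_
  rw [one_mul]
  have hc : (2 * H + 1) ^ (n * (n - S.card)) = (mbox (Fin n) {j : Fin n // j ∉ S} H).card := by
    rw [card_mbox]
    congr 2
    · simp
    · rw [Fintype.card_subtype_compl]; simp
  rw [hc, ← Finset.card_product]
  refine Finset.card_le_card_of_injOn (fun A => (fun i j => A i j.1, fun i j => A i j.1)) ?_ ?_
  · intro A hA
    rw [Finset.mem_coe, Finset.mem_filter, mem_Sing] at hA
    rw [Finset.mem_coe, Finset.mem_product, mem_Bset]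
    refine ⟨?_, ?_, hA.2⟩
    · rw [mem_mbox]
      exact fun i => mem_zbox.2 fun j => mem_zbox.1 (mem_mbox.1 hA.1.1 i) j.1
    · rw [mem_mbox]
      exact fun i => mem_zbox.2 fun j => mem_zbox.1 (mem_mbox.1 hA.1.1 i) j.1
  · intro A _ A' _ h
    simp only [Prod.mk.injEq] at h
    ext i j
    by_cases hj : j ∈ S
    · exact congrFun (congrFun h.2 i) ⟨j, hj⟩
    · exact congrFun (congrFun h.1 i) ⟨j, hj⟩

/-- The entries of the scalar matrix `l`, as a plain function. -/
def scal (n : ℕ) (l : ℂ) : Fin n → Fin n → ℂ := fun i j => if i = j then l else 0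

lemma root_of_det_zero {n : ℕ} (hn : 1 ≤ n) (F : Polynomial ℂ) (hF : F ≠ 0)
    (A : Matrix (Fin n) (Fin n) ℤ)
    (h : (Polynomial.aeval (A.map (Int.cast : ℤ → ℂ)) F).det = 0) :
    ∃ l ∈ F.roots.toFinset, kerB (scal n l) (fun i j => A i j) ≠ ⊥ := by
  classical
  have : Nonempty (Fin n) := ⟨⟨0, hn⟩⟩
  set M := A.map (Int.cast : ℤ → ℂ)
  have h0 : (0 : ℂ) ∈ spectrum ℂ (Polynomial.aeval M F) := by
    rw [spectrum.zero_mem_iff, Matrix.isUnit_iff_isUnit_det, h]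
    simp
  rw [spectrum.map_polynomial_aeval_of_nonempty M F
    (spectrum.nonempty_of_isAlgClosed_of_finiteDimensional ℂ M)] at h0
  obtain ⟨l, hl, hl0⟩ := h0
  refine ⟨l, by simpa [hF] using hl0, ?_⟩
  rw [spectrum.mem_iff, Matrix.isUnit_iff_isUnit_det, isUnit_iff_ne_zero, not_not] at hl
  obtain ⟨u, hu0, hu⟩ := Matrix.exists_mulVec_eq_zero_iff.2 hl
  intro hbot
  apply hu0
  have : u ∈ kerB (scal n l) (fun i j => A i j) := by
    refine mem_kerB.2 fun i => ?_
    have h1 := congrFun hu i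
    rw [Matrix.sub_mulVec] at h1
    rw [sub_dotProduct]
    have h2 : (M *ᵥ u) i = cc (fun j => A i j) ⬝ᵥ u := rfl
    have h3 : ((algebraMap ℂ (Matrix (Fin n) (Fin n) ℂ)) l *ᵥ u) i =
      scal n l i ⬝ᵥ u := by
      simp [Matrix.mulVec, dotProduct, scal, Matrix.algebraMap_matrix_apply]
    rw [Pi.sub_apply, h2, h3, Pi.zero_apply] at h1
    linear_combination -h1
  rw [hbot] at this
  simpa using this

lemma Bd.eventually {f : ℕ → ℕ} {a : ℕ} (hf : Bd f a) (ε : ℝ) (hε : 0 < ε) :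
    ∃ H₀ : ℕ, ∀ H : ℕ, H₀ ≤ H → (f H : ℝ) ≤ (H : ℝ) ^ ((a : ℝ) + ε) := by
  obtain ⟨C, hC, hb⟩ := hf
  have h1 : (fun x : ℝ => C * (1 + Real.log x)) =o[Filter.atTop] fun x : ℝ => x ^ ε := by
    refine Asymptotics.IsLittleO.const_mul_left (Asymptotics.IsLittleO.add ?_
      (isLittleO_log_rpow_atTop hε)) _
    rw [Asymptotics.isLittleO_const_left]
    exact Or.inr (tendsto_norm_atTop_atTop.comp (tendsto_rpow_atTop hε))
  have h2 := (h1.bound one_pos)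
  have h3 := tendsto_natCast_atTop_atTop.eventually h2
  obtain ⟨H₀, hH₀⟩ := Filter.eventually_atTop.1 h3
  refine ⟨max H₀ 1, fun H hH => (hb H (le_of_max_le_right hH)).trans ?_⟩
  have h4 := hH₀ H (le_of_max_le_left hH)
  have hHpos : (0 : ℝ) < H := by exact_mod_cast (le_of_max_le_right hH : 1 ≤ H)
  rw [one_mul, Real.norm_of_nonneg (by positivity : (0 : ℝ) ≤ (H : ℝ) ^ ε)] at h4
  have h5 := (le_abs_self _).trans h4
  rw [Real.rpow_add hHpos, Real.rpow_natCast]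
  calc C * (H : ℝ) ^ a * (1 + Real.log H) = (H : ℝ) ^ a * (C * (1 + Real.log H)) := by ring
    _ ≤ _ := by gcongr

/-- Bound (5.3): for a fixed nonzero `F ∈ ℂ[X]`, the number of matrices `A ∈ M_n(ℤ;H)` with
`det F(A) = 0` is at most `H^(n²-n+ε)` for `H` large. -/
theorem singular_matrix_polynomial_count (n : ℕ) (hn : 1 ≤ n) (F : Polynomial ℂ)
    (hF : F ≠ 0) :
    ∀ ε : ℝ, 0 < ε → ∃ H₀ : ℕ, ∀ H : ℕ, H₀ ≤ H →
      (Set.ncard {A : Matrix (Fin n) (Fin n) ℤ | (∀ i j, |A i j| ≤ (H : ℤ)) ∧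
        (Polynomial.aeval (A.map (Int.cast : ℤ → ℂ)) F).det = 0} : ℝ) ≤
      (H : ℝ) ^ ((n : ℝ) ^ 2 - n + ε) := by
  classical
  intro ε hε
  have hbd : Bd (fun H => ∑ l ∈ F.roots.toFinset,
      (Sing (scal n l) H).card) (n * (n - 1)) :=
    Bd.sum _ fun l _ => Sing_bound hn _
  obtain ⟨H₀, hH₀⟩ := hbd.eventually ε hε
  refine ⟨H₀, fun H hH => ?_⟩
  have he : (n : ℝ) ^ 2 - n + ε = ((n * (n - 1) : ℕ) : ℝ) + ε := by
    push_cast [Nat.cast_sub hn]; ring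
  rw [he]
  refine le_trans ?_ (hH₀ H hH)
  have h1 := Set.ncard_le_ncard_of_injOn
    (s := {A : Matrix (Fin n) (Fin n) ℤ | (∀ i j, |A i j| ≤ (H : ℤ)) ∧
        (Polynomial.aeval (A.map (Int.cast : ℤ → ℂ)) F).det = 0})
    (t := ((F.roots.toFinset.biUnion fun l => Sing (scal n l) H : Finset (Fin n → Fin n → ℤ)) :
        Set (Fin n → Fin n → ℤ)))
    (fun A i j => A i j)
    (by
      rintro A ⟨hA, hdet⟩
      obtain ⟨l, hl, hk⟩ := root_of_det_zero hn F hF A hdet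
      exact Finset.mem_coe.2 (Finset.mem_biUnion.2
        ⟨l, hl, mem_Sing.2 ⟨mem_mbox.2 fun i => mem_zbox.2 (hA i), hk⟩⟩))
    (fun A _ B _ h => Matrix.ext fun i j => congrFun (congrFun h i) j)
    (Finset.finite_toSet _)
  rw [Set.ncard_coe_finset] at h1
  exact_mod_cast h1.trans Finset.card_biUnion_le
end

section
/- Fix an integer n ≥ 1. There exists a constant C > 0 (depending only on n) such that for all integers H ≥ 2 and all real numbers T ≥ 0, the number of matrices A ∈ M_n(ℤ;H) with |det A| ≤ T is at most C · (T + 1) · H^(n² − n) · log H. -/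
open Matrix Polynomial

/-- Integer box of radius `H`. -/
noncomputable def bx (m H : ℕ) : Finset (Fin m → ℤ) :=
  Fintype.piFinset fun _ => Finset.Icc (-(H : ℤ)) H

lemma mem_bx {m H : ℕ} {v : Fin m → ℤ} : v ∈ bx m H ↔ ∀ j, |v j| ≤ (H : ℤ) := by
  simp [bx, abs_le]

lemma card_bx (m H : ℕ) : (bx m H).card = (2 * H + 1) ^ m := by
  have : ((H : ℤ) + 1 + H).toNat = 2 * H + 1 := by omega
  simp [bx, this]

lemma exists_bezout {m : ℕ} (γ : Fin (m + 1) → ℤ) (h : γ ≠ 0) :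
    ∃ (g : ℤ) (c u : Fin (m + 1) → ℤ), g ≠ 0 ∧ (∀ l, γ l = g * c l) ∧ ∑ l, u l * c l = 1 := by
  obtain ⟨g, hg⟩ := (IsPrincipalIdealRing.principal (Ideal.span (Set.range γ))).principal
  have hmem : ∀ l, ∃ x, γ l = g * x := by
    intro l
    have : γ l ∈ Ideal.span (Set.range γ) := Ideal.subset_span ⟨l, rfl⟩
    rw [hg] at this
    obtain ⟨x, hx⟩ := Submodule.mem_span_singleton.1 this
    exact ⟨x, by rw [← hx, smul_eq_mul, mul_comm]⟩
  choose c hc using hmem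
  have hg0 : g ≠ 0 := by
    rintro rfl
    exact h (funext fun l => by simp [hc l])
  have : g ∈ Ideal.span (Set.range γ) := by
    rw [hg]; exact Submodule.mem_span_singleton_self g
  obtain ⟨u, hu⟩ := Ideal.mem_span_range_iff_exists_fun.1 this
  refine ⟨g, c, u, hg0, hc, ?_⟩
  apply mul_left_cancel₀ hg0
  rw [Finset.mul_sum, mul_one]
  conv_rhs => rw [← hu]
  exact Finset.sum_congr rfl fun l _ => by rw [hc l]; ring

lemma exists_rep {m H : ℕ} (c u : Fin (m + 1) → ℤ) (hu : ∑ l, u l * c l = 1)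
    (B : Matrix (Fin (m + 1)) (Fin (m + 1)) ℤ) (hB : B.det ≠ 0) (i k : Fin (m + 1))
    (hi : B i = Pi.single k 1) (hH : ∀ j, j ≠ i → B j ∈ bx (m + 1) H)
    (h0 : ∀ j, j ≠ i → ∑ l, c l * B j l = 0) (t : ℤ) :
    ∃ w : Fin (m + 1) → ℤ, (∀ l, l ≠ k → |w l| ≤ (((m + 1) * H : ℕ) : ℤ)) ∧
      ∑ l, c l * w l = t := by
  set Bq : Matrix (Fin (m + 1)) (Fin (m + 1)) ℚ := B.map (Int.castRingHom ℚ) with hBq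
  have hdet : IsUnit Bq.det := by
    rw [hBq, ← RingHom.mapMatrix_apply, ← RingHom.map_det]
    simpa using hB
  set lam : Fin (m + 1) → ℚ := (fun l => ((t * u l : ℤ) : ℚ)) ᵥ* Bq⁻¹ with hlam
  have hsol : ∀ l, ((t * u l : ℤ) : ℚ) = ∑ j, lam j * B j l := by
    intro l
    have : lam ᵥ* Bq = (fun l => ((t * u l : ℤ) : ℚ)) := by
      rw [hlam, Matrix.vecMul_vecMul, Matrix.nonsing_inv_mul _ hdet, Matrix.vecMul_one]
    have := congrFun this l
    rw [← this]
    simp [Matrix.vecMul, dotProduct, hBq]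
  refine ⟨fun l => t * u l - ∑ j ∈ Finset.univ.erase i, ⌊lam j⌋ * B j l, ?_, ?_⟩
  · intro l hl
    have e : ((t * u l - ∑ j ∈ Finset.univ.erase i, ⌊lam j⌋ * B j l : ℤ) : ℚ)
        = ∑ j ∈ Finset.univ.erase i, Int.fract (lam j) * B j l := by
      rw [Int.cast_sub, hsol l, ← Finset.add_sum_erase _ _ (Finset.mem_univ i)]
      simp only [hi, Pi.single_eq_of_ne hl, Int.cast_zero, mul_zero, zero_add, Int.cast_sum,
        ← Finset.sum_sub_distrib]
      refine Finset.sum_congr rfl fun j _ => ?_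
      rw [Int.fract]; push_cast; ring
    have : |((t * u l - ∑ j ∈ Finset.univ.erase i, ⌊lam j⌋ * B j l : ℤ) : ℚ)|
        ≤ (((m + 1) * H : ℕ) : ℚ) := by
      rw [e]
      refine (Finset.abs_sum_le_sum_abs _ _).trans ?_
      have : ∀ j ∈ Finset.univ.erase i, |Int.fract (lam j) * (B j l : ℚ)| ≤ H := by
        intro j hj
        have hb : |(B j l : ℚ)| ≤ H := by
          exact_mod_cast mem_bx.1 (hH j (Finset.ne_of_mem_erase hj)) l
        rw [abs_mul, abs_of_nonneg (Int.fract_nonneg _)]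
        have h1 := (Int.fract_lt_one (lam j)).le
        have h2 := Int.fract_nonneg (lam j)
        nlinarith [abs_nonneg (B j l : ℚ)]
      refine (Finset.sum_le_card_nsmul _ _ _ this).trans ?_
      rw [Finset.card_erase_of_mem (Finset.mem_univ _)]
      simp only [Finset.card_univ, Fintype.card_fin, nsmul_eq_mul]
      push_cast
      have : (0 : ℚ) ≤ H := by positivity
      nlinarith
    exact_mod_cast this
  · have : ∑ l, c l * (t * u l - ∑ j ∈ Finset.univ.erase i, ⌊lam j⌋ * B j l)
      = t * (∑ l, u l * c l) - ∑ j ∈ Finset.univ.erase i, ⌊lam j⌋ * ∑ l, c l * B j l := by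
      simp only [mul_sub, Finset.sum_sub_distrib, Finset.mul_sum]
      congr 1
      · exact Finset.sum_congr rfl fun _ _ => by ring
      · rw [Finset.sum_comm]
        exact Finset.sum_congr rfl fun _ _ => Finset.sum_congr rfl fun _ _ => by ring
    rw [this, hu, Finset.sum_eq_zero]
    · ring
    · intro j hj
      rw [h0 j (Finset.ne_of_mem_erase hj), mul_zero]

lemma count_hyperplane {m H : ℕ} (c u : Fin (m + 1) → ℤ) (hu : ∑ l, u l * c l = 1)
    (B : Matrix (Fin (m + 1)) (Fin (m + 1)) ℤ) (hB : B.det ≠ 0) (i k : Fin (m + 1))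
    (hk : c k ≠ 0)
    (hi : B i = Pi.single k 1) (hH : ∀ j, j ≠ i → B j ∈ bx (m + 1) H)
    (h0 : ∀ j, j ≠ i → ∑ l, c l * B j l = 0) (d : ℤ) :
    ((bx (m + 1) H).filter fun v => ∑ l, c l * v l = d).card * (c k).natAbs
      ≤ (2 * ((m + 2) * H) + 1) ^ m := by
  choose w hw1 hw2 using exists_rep c u hu B hB i k hi hH h0
  rw [← card_bx]
  conv_lhs => rw [← Finset.card_range (c k).natAbs, ← Finset.card_product]
  refine Finset.card_le_card_of_injOn
    (fun p j => p.1 (k.succAbove j) + w (p.2 : ℤ) (k.succAbove j)) ?_ ?_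
  · rintro ⟨v, t⟩ hp
    simp only [Finset.coe_product, Set.mem_prod, Finset.mem_coe, Finset.mem_filter,
      Finset.mem_range] at hp
    rw [Finset.mem_coe, mem_bx]
    intro j
    have h1 := mem_bx.1 hp.1.1 (k.succAbove j)
    have h2 := hw1 t (k.succAbove j) (Fin.succAbove_ne k j)
    refine (abs_add_le _ _).trans ?_
    push_cast at h2 ⊢
    linarith
  · rintro ⟨v, t⟩ hp ⟨v', t'⟩ hp' heq
    simp only [Finset.coe_product, Set.mem_prod, Finset.mem_coe, Finset.mem_filter,
      Finset.mem_range] at hp hp'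
    have heq' : ∀ j, v (k.succAbove j) + w (t : ℤ) (k.succAbove j)
        = v' (k.succAbove j) + w (t' : ℤ) (k.succAbove j) := fun j => congrFun heq j
    have e1 : d + t = c k * (v k + w t k) + ∑ j, c (k.succAbove j) *
        (v (k.succAbove j) + w (t : ℤ) (k.succAbove j)) := by
      rw [← hp.1.2]
      conv_lhs => rw [← hw2 t]
      rw [← Finset.sum_add_distrib, Fin.sum_univ_succAbove _ k]
      simp only [mul_add]
    have e2 : d + t' = c k * (v' k + w t' k) + ∑ j, c (k.succAbove j) *
        (v' (k.succAbove j) + w (t' : ℤ) (k.succAbove j)) := by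
      rw [← hp'.1.2]
      conv_lhs => rw [← hw2 t']
      rw [← Finset.sum_add_distrib, Fin.sum_univ_succAbove _ k]
      simp only [mul_add]
    simp only [heq'] at e1
    have hdvd : c k ∣ (t : ℤ) - t' :=
      ⟨(v k + w t k) - (v' k + w t' k), by linear_combination e1 - e2⟩
    have htt : t = t' := by
      have := Int.natAbs_dvd_natAbs.2 hdvd
      have h3 := Nat.eq_zero_of_dvd_of_lt this (by omega)
      omega
    subst htt
    have hv : ∀ j, v (k.succAbove j) = v' (k.succAbove j) := fun j => by
      have := heq' j; linarith
    have hvk : v k = v' k := by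
      have f1 := hp.1.2
      have f2 := hp'.1.2
      rw [Fin.sum_univ_succAbove _ k] at f1 f2
      simp only [hv] at f1
      exact mul_left_cancel₀ hk (by linarith)
    have : v = v' := by
      funext l
      rcases Fin.eq_self_or_eq_succAbove k l with rfl | ⟨j, rfl⟩
      · exact hvk
      · exact hv j
    rw [this]

/-- Box of integer matrices. -/
noncomputable def mb (m H : ℕ) : Finset (Matrix (Fin (m + 1)) (Fin (m + 1)) ℤ) :=
  Fintype.piFinset fun _ => bx (m + 1) H

lemma mem_mb {m H : ℕ} {A : Matrix (Fin (m + 1)) (Fin (m + 1)) ℤ} :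
    A ∈ mb m H ↔ ∀ i j, |A i j| ≤ (H : ℤ) := by
  exact Fintype.mem_piFinset.trans (forall_congr' fun i => mem_bx)

lemma row_mem_bx {m H : ℕ} {A : Matrix (Fin (m + 1)) (Fin (m + 1)) ℤ} (h : A ∈ mb m H)
    (i : Fin (m + 1)) : A i ∈ bx (m + 1) H := mem_bx.2 (mem_mb.1 h i)

lemma row_adj {m : ℕ} (A : Matrix (Fin (m + 1)) (Fin (m + 1)) ℤ) (i j : Fin (m + 1)) :
    ∑ l, A j l * A.adjugate l i = if j = i then A.det else 0 := by
  have := congrFun (congrFun (Matrix.mul_adjugate A) j) i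
  rw [Matrix.mul_apply] at this
  rw [this]
  simp [Matrix.one_apply]

lemma adj_congr {m : ℕ} (A A' : Matrix (Fin (m + 1)) (Fin (m + 1)) ℤ) (i l : Fin (m + 1))
    (h : ∀ j, A (i.succAbove j) = A' (i.succAbove j)) : A.adjugate l i = A'.adjugate l i := by
  rw [Matrix.adjugate_apply, Matrix.adjugate_apply]
  congr 1
  ext r s
  rcases Fin.eq_self_or_eq_succAbove i r with rfl | ⟨j, rfl⟩
  · simp
  · rw [Matrix.updateRow_ne (Fin.succAbove_ne i j), Matrix.updateRow_ne (Fin.succAbove_ne i j), h]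

open Classical in
lemma count_class {m H : ℕ} (i k : Fin (m + 1)) (c u : Fin (m + 1) → ℤ)
    (hu : ∑ l, u l * c l = 1) (hk : c k ≠ 0) (d : ℤ) :
    ((mb m H).filter fun A => A.det = d ∧ ∃ g : ℤ, g ≠ 0 ∧ ∀ l, A.adjugate l i = g * c l).card
      * (c k).natAbs ^ (m + 1) ≤ ((2 * ((m + 2) * H) + 1) ^ m) ^ (m + 1) := by
  set S := (mb m H).filter fun A => A.det = d ∧ ∃ g : ℤ, g ≠ 0 ∧ ∀ l, A.adjugate l i = g * c l
    with hS
  set K := (2 * ((m + 2) * H) + 1) ^ m with hK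
  have hkpos : 0 < (c k).natAbs := Int.natAbs_pos.2 hk
  -- rows other than `i` are orthogonal to `c`
  have horth : ∀ A ∈ S, ∀ j, j ≠ i → ∑ l, c l * A j l = 0 := by
    intro A hA j hj
    obtain ⟨-, -, g, hg, hadj⟩ := Finset.mem_filter.1 hA
    have := row_adj A i j
    rw [if_neg hj] at this
    simp only [hadj] at this
    apply mul_left_cancel₀ hg
    rw [mul_zero, ← this, Finset.mul_sum]
    exact Finset.sum_congr rfl fun _ _ => by ring
  rcases S.eq_empty_or_nonempty with he | ⟨A0, hA0⟩
  · rw [he]; simp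
  have hN : ∀ d' : ℤ, ((bx (m + 1) H).filter fun v => ∑ l, c l * v l = d').card
      ≤ K / (c k).natAbs := by
    intro d'
    rw [Nat.le_div_iff_mul_le hkpos]
    obtain ⟨hmem, -, g, hg, hadj⟩ := Finset.mem_filter.1 hA0
    refine count_hyperplane c u hu (A0.updateRow i (Pi.single k 1)) ?_ i k hk ?_ ?_ ?_ d'
    · rw [← Matrix.adjugate_apply, hadj]
      exact mul_ne_zero hg hk
    · simp
    · intro j hj
      rw [Matrix.updateRow_ne hj]
      exact row_mem_bx hmem j
    · intro j hj
      rw [Matrix.updateRow_ne hj]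
      exact horth A0 hA0 j hj
  set M := K / (c k).natAbs with hM
  have hcard : S.card ≤ M * M ^ m := by
    set f : Matrix (Fin (m + 1)) (Fin (m + 1)) ℤ → (Fin m → Fin (m + 1) → ℤ) :=
      fun A j => A (i.succAbove j) with hf
    have h1 : S.card ≤ M * (S.image f).card := by
      apply Finset.card_le_mul_card_image
      intro b hb
      obtain ⟨A1, hA1, rfl⟩ := Finset.mem_image.1 hb
      obtain ⟨-, -, g, hg, hadj⟩ := Finset.mem_filter.1 hA1
      refine le_trans ?_ (hN (d / g))
      refine Finset.card_le_card_of_injOn (fun A => A i) ?_ ?_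
      · intro A hA
        obtain ⟨hA, hAf⟩ := Finset.mem_filter.1 (Finset.mem_coe.1 hA)
        obtain ⟨hmem, hdet, -⟩ := Finset.mem_filter.1 hA
        rw [Finset.mem_coe, Finset.mem_filter]
        refine ⟨row_mem_bx hmem i, ?_⟩
        have := row_adj A i i
        rw [if_pos rfl, hdet] at this
        have e : ∀ l, A.adjugate l i = g * c l := fun l => by
          rw [← hadj, adj_congr A A1 i l fun j => congrFun hAf j]
        simp only [e] at this
        rw [← this]
        symm
        apply Int.ediv_eq_of_eq_mul_right hg
        rw [Finset.mul_sum]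
        exact Finset.sum_congr rfl fun _ _ => by ring
      · intro A hA A' hA' heq
        obtain ⟨-, hAf⟩ := Finset.mem_filter.1 (Finset.mem_coe.1 hA)
        obtain ⟨-, hAf'⟩ := Finset.mem_filter.1 (Finset.mem_coe.1 hA')
        funext r
        rcases Fin.eq_self_or_eq_succAbove i r with rfl | ⟨j, rfl⟩
        · exact heq
        · exact congrFun (hAf.trans hAf'.symm) j
    have h2 : (S.image f).card ≤ M ^ m := by
      have hsub : S.image f ⊆ Fintype.piFinset fun _ : Fin m =>
          (bx (m + 1) H).filter fun v => ∑ l, c l * v l = 0 := by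
        intro b hb
        obtain ⟨A1, hA1, rfl⟩ := Finset.mem_image.1 hb
        rw [Fintype.mem_piFinset]
        intro j
        rw [Finset.mem_filter]
        exact ⟨row_mem_bx (Finset.mem_filter.1 hA1).1 _, horth A1 hA1 _ (Fin.succAbove_ne i j)⟩
      refine (Finset.card_le_card hsub).trans ?_
      rw [Fintype.card_piFinset_const]
      exact Nat.pow_le_pow_left (hN 0) m
    exact h1.trans (Nat.mul_le_mul_left _ h2)
  calc S.card * (c k).natAbs ^ (m + 1) ≤ M * M ^ m * (c k).natAbs ^ (m + 1) :=
        Nat.mul_le_mul_right _ hcard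
    _ = (M * (c k).natAbs) ^ (m + 1) := by rw [mul_pow]; ring
    _ ≤ K ^ (m + 1) := Nat.pow_le_pow_left (Nat.div_mul_le_self _ _) _

open Classical in
lemma count_a {m H : ℕ} (i k : Fin (m + 1)) (a : ℤ) (ha : a ≠ 0) (d : ℤ) :
    ((mb m H).filter fun A => A.det = d ∧ ∃ c u : Fin (m + 1) → ℤ, ∑ l, u l * c l = 1 ∧
      c k = a ∧ (∀ l, |c l| ≤ |a|) ∧ ∃ g : ℤ, g ≠ 0 ∧ ∀ l, A.adjugate l i = g * c l).card
      * a.natAbs ≤ 3 ^ m * ((2 * ((m + 2) * H) + 1) ^ m) ^ (m + 1) := by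
  set S := (mb m H).filter fun A => A.det = d ∧ ∃ c u : Fin (m + 1) → ℤ, ∑ l, u l * c l = 1 ∧
      c k = a ∧ (∀ l, |c l| ≤ |a|) ∧ ∃ g : ℤ, g ≠ 0 ∧ ∀ l, A.adjugate l i = g * c l with hS
  set K := (2 * ((m + 2) * H) + 1) ^ m with hK
  have hapos : 0 < a.natAbs := Int.natAbs_pos.2 ha
  set P := ((bx m a.natAbs).image fun w => (k.insertNth a w : Fin (m + 1) → ℤ)).filter
    fun c => ∃ u : Fin (m + 1) → ℤ, ∑ l, u l * c l = 1 with hP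
  have hPc : P.card ≤ (3 * a.natAbs) ^ m := by
    refine (Finset.card_filter_le _ _).trans (Finset.card_image_le.trans ?_)
    rw [card_bx]
    exact Nat.pow_le_pow_left (by omega) m
  have hsub : S ⊆ P.biUnion fun c =>
      (mb m H).filter fun A => A.det = d ∧ ∃ g : ℤ, g ≠ 0 ∧ ∀ l, A.adjugate l i = g * c l := by
    intro A hA
    obtain ⟨hmem, hdet, c, u, hu, hck, hcl, hg⟩ := Finset.mem_filter.1 hA
    refine Finset.mem_biUnion.2 ⟨c, ?_, Finset.mem_filter.2 ⟨hmem, hdet, hg⟩⟩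
    refine Finset.mem_filter.2 ⟨Finset.mem_image.2 ⟨fun j => c (k.succAbove j), ?_, ?_⟩, u, hu⟩
    · rw [mem_bx]
      intro j
      rw [Int.natCast_natAbs]
      exact hcl _
    · funext l
      rcases Fin.eq_self_or_eq_succAbove k l with rfl | ⟨j, rfl⟩
      · simp [hck]
      · simp
  have hc1 : S.card * a.natAbs ^ (m + 1) ≤ (3 * a.natAbs) ^ m * K ^ (m + 1) := by
    calc S.card * a.natAbs ^ (m + 1) ≤ (∑ c ∈ P, ((mb m H).filter fun A => A.det = d ∧
          ∃ g : ℤ, g ≠ 0 ∧ ∀ l, A.adjugate l i = g * c l).card) * a.natAbs ^ (m + 1) :=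
          Nat.mul_le_mul_right _ ((Finset.card_le_card hsub).trans Finset.card_biUnion_le)
      _ ≤ ∑ c ∈ P, K ^ (m + 1) := by
          rw [Finset.sum_mul]
          refine Finset.sum_le_sum fun c hc => ?_
          obtain ⟨hc, u, hu⟩ := Finset.mem_filter.1 hc
          obtain ⟨w, -, rfl⟩ := Finset.mem_image.1 hc
          have := count_class (H := H) i k (k.insertNth a w : Fin (m + 1) → ℤ) u hu
            (by simpa using ha) d
          simpa using this
      _ = P.card * K ^ (m + 1) := by simp
      _ ≤ _ := Nat.mul_le_mul_right _ hPc
  have : (S.card * a.natAbs) * a.natAbs ^ m ≤ (3 ^ m * K ^ (m + 1)) * a.natAbs ^ m := by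
    calc _ = S.card * a.natAbs ^ (m + 1) := by ring
      _ ≤ _ := hc1
      _ = _ := by rw [mul_pow]; ring
  exact Nat.le_of_mul_le_mul_right this (by positivity)

lemma sum_inv_abs (X : ℕ) :
    ∑ a ∈ (Finset.Icc (-(X : ℤ)) X).erase 0, ((a.natAbs : ℝ))⁻¹ ≤ 2 * (1 + Real.log X) := by
  have h1 : ∀ a ∈ (Finset.Icc (-(X : ℤ)) X).erase 0, a.natAbs ∈ Finset.Icc 1 X := by
    intro a ha
    simp only [Finset.mem_erase, Finset.mem_Icc] at ha ⊢
    omega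
  rw [← Finset.sum_fiberwise_of_maps_to h1]
  have h2 : ∑ b ∈ Finset.Icc 1 X, ((b : ℝ))⁻¹ ≤ 1 + Real.log X := by
    have := harmonic_le_one_add_log X
    rw [harmonic_eq_sum_Icc] at this
    push_cast at this
    exact this
  refine le_trans ?_ (mul_le_mul_of_nonneg_left h2 (by norm_num))
  rw [Finset.mul_sum]
  refine Finset.sum_le_sum fun b _ => ?_
  have : ∀ a ∈ ((Finset.Icc (-(X : ℤ)) X).erase 0).filter (fun a => a.natAbs = b),
      ((a.natAbs : ℝ))⁻¹ ≤ (b : ℝ)⁻¹ := by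
    intro a ha
    rw [(Finset.mem_filter.1 ha).2]
  refine (Finset.sum_le_card_nsmul _ _ _ this).trans ?_
  rw [nsmul_eq_mul]
  refine mul_le_mul_of_nonneg_right ?_ (by positivity)
  have : (((Finset.Icc (-(X : ℤ)) X).erase 0).filter (fun a => a.natAbs = b)).card
      ≤ ({(b : ℤ), -(b : ℤ)} : Finset ℤ).card := by
    apply Finset.card_le_card
    intro a ha
    have := (Finset.mem_filter.1 ha).2
    simp only [Finset.mem_insert, Finset.mem_singleton]
    omega
  exact_mod_cast this.trans Finset.card_le_two

lemma adj_bound {m H : ℕ} (hH : 1 ≤ H) {A : Matrix (Fin (m + 1)) (Fin (m + 1)) ℤ}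
    (hA : A ∈ mb m H) (k i : Fin (m + 1)) :
    |A.adjugate k i| ≤ (((m + 1).factorial * H ^ (m + 1) : ℕ) : ℤ) := by
  rw [Matrix.adjugate_apply]
  have := Matrix.det_le (A := A.updateRow i (Pi.single k 1)) (abv := AbsoluteValue.abs)
    (x := (H : ℤ)) ?_
  · simpa using this
  · intro r s
    rw [AbsoluteValue.abs_apply]
    by_cases hr : r = i
    · subst hr
      rw [Matrix.updateRow_self]
      by_cases hs : s = k
      · subst hs; simp; omega
      · simp [hs]
    · rw [Matrix.updateRow_ne hr]
      exact mem_mb.1 hA r s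

open Classical in
lemma count_ik {m H : ℕ} (hH : 1 ≤ H) (i k : Fin (m + 1)) (d : ℤ) :
    (((mb m H).filter fun A => A.det = d ∧ A.adjugate k i ≠ 0 ∧
      ∀ l, |A.adjugate l i| ≤ |A.adjugate k i|).card : ℝ) ≤
      3 ^ m * ((2 * ((m + 2) * H) + 1) ^ m) ^ (m + 1) *
        (2 * (1 + Real.log (((m + 1).factorial * H ^ (m + 1) : ℕ) : ℝ))) := by
  set X := (m + 1).factorial * H ^ (m + 1) with hX
  set Q : ℤ → Finset (Matrix (Fin (m + 1)) (Fin (m + 1)) ℤ) := fun a =>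
    (mb m H).filter fun A => A.det = d ∧ ∃ c u : Fin (m + 1) → ℤ, ∑ l, u l * c l = 1 ∧
      c k = a ∧ (∀ l, |c l| ≤ |a|) ∧ ∃ g : ℤ, g ≠ 0 ∧ ∀ l, A.adjugate l i = g * c l with hQ
  have hsub : ((mb m H).filter fun A => A.det = d ∧ A.adjugate k i ≠ 0 ∧
      ∀ l, |A.adjugate l i| ≤ |A.adjugate k i|) ⊆
      ((Finset.Icc (-(X : ℤ)) X).erase 0).biUnion Q := by
    intro A hA
    obtain ⟨hmem, hdet, hne, hmax⟩ := Finset.mem_filter.1 hA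
    obtain ⟨g, c, u, hg, hc, hu⟩ := exists_bezout (fun l => A.adjugate l i)
      (fun h => hne (congrFun h k))
    have hgpos : 0 < |g| := abs_pos.2 hg
    have hmax' : ∀ l, |c l| ≤ |c k| := by
      intro l
      have := hmax l
      rw [hc, hc, abs_mul, abs_mul] at this
      exact le_of_mul_le_mul_left this hgpos
    have hckne : c k ≠ 0 := by
      intro h; apply hne; rw [hc, h, mul_zero]
    have hckle : |c k| ≤ X := by
      have := adj_bound hH hmem k i
      rw [hc, abs_mul] at this
      have h1 : 1 ≤ |g| := hgpos
      nlinarith [abs_nonneg (c k)]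
    refine Finset.mem_biUnion.2 ⟨c k, ?_, Finset.mem_filter.2
      ⟨hmem, hdet, c, u, hu, rfl, hmax', g, hg, hc⟩⟩
    rw [Finset.mem_erase, Finset.mem_Icc]
    exact ⟨hckne, abs_le.1 hckle⟩
  have h1 := (Finset.card_le_card hsub).trans Finset.card_biUnion_le
  have h2 : ((((mb m H).filter fun A => A.det = d ∧ A.adjugate k i ≠ 0 ∧
      ∀ l, |A.adjugate l i| ≤ |A.adjugate k i|).card : ℕ) : ℝ)
      ≤ ∑ a ∈ (Finset.Icc (-(X : ℤ)) X).erase 0, ((Q a).card : ℝ) := by exact_mod_cast h1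
  refine h2.trans ?_
  refine le_trans ?_ (mul_le_mul_of_nonneg_left (sum_inv_abs X) (by positivity))
  rw [Finset.mul_sum]
  refine Finset.sum_le_sum fun a ha => ?_
  have ha0 := Finset.ne_of_mem_erase ha
  have hpos : (0 : ℝ) < a.natAbs := by exact_mod_cast Int.natAbs_pos.2 ha0
  rw [← div_eq_mul_inv, le_div_iff₀ hpos]
  exact_mod_cast count_a (H := H) i k a ha0 d

lemma det_add_diag {m : ℕ} (A : Matrix (Fin (m + 1)) (Fin (m + 1)) ℤ) (i : Fin (m + 1)) (x : ℤ) :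
    (A + Matrix.diagonal (Pi.single i x)).det = A.det + x * A.adjugate i i := by
  have : A + Matrix.diagonal (Pi.single i x) = A.updateRow i (A i + x • Pi.single i 1) := by
    ext r c
    by_cases hr : r = i
    · subst hr
      by_cases hc : r = c
      · subst hc; simp
      · simp [Matrix.diagonal_apply_ne _ hc, Pi.single_eq_of_ne (Ne.symm hc)]
    · rw [Matrix.updateRow_ne hr]
      by_cases hc : r = c
      · subst hc; simp [hr]
      · simp [Matrix.diagonal_apply_ne _ hc]
  rw [this, Matrix.det_updateRow_add, Matrix.det_updateRow_smul, Matrix.updateRow_eq_self,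
    Matrix.adjugate_apply]

lemma exists_diag (n : ℕ) (A : Matrix (Fin n) (Fin n) ℤ) (s : Fin n → ℤ) (hs : ∀ i, s i ≠ 0) :
    ∃ t : Finset (Fin n), (A + Matrix.diagonal fun i => if i ∈ t then s i else 0).det ≠ 0 := by
  induction n with
  | zero => exact ⟨∅, by simp⟩
  | succ m ih =>
    obtain ⟨t, ht⟩ := ih (A.submatrix Fin.succ Fin.succ) (fun i => s i.succ) fun i => hs _
    set M := A + Matrix.diagonal fun i => if i ∈ t.map (Fin.succEmb m) then s i else 0 with hM
    have hadj : M.adjugate 0 0 ≠ 0 := by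
      rw [Matrix.adjugate_fin_succ_eq_det_submatrix]
      have : M.submatrix (Fin.succAbove 0) (Fin.succAbove 0) =
          A.submatrix Fin.succ Fin.succ + Matrix.diagonal fun i => if i ∈ t then s i.succ else 0 := by
        ext r c
        by_cases h : r = c
        · subst h; simp [hM]
        · simp [hM, Matrix.diagonal_apply_ne _ h, h]
      rw [this]
      simpa using ht
    by_cases h0 : M.det = 0
    · refine ⟨insert 0 (t.map (Fin.succEmb m)), ?_⟩
      have : (A + Matrix.diagonal fun i =>
          if i ∈ insert 0 (t.map (Fin.succEmb m)) then s i else 0)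
          = M + Matrix.diagonal (Pi.single 0 (s 0)) := by
        rw [hM, add_assoc, Matrix.diagonal_add]
        congr 2
        funext i
        refine Fin.cases ?_ (fun j => ?_) i
        · simp
        · simp
      rw [this, det_add_diag, h0, zero_add]
      exact mul_ne_zero (hs 0) hadj
    · exact ⟨_, h0⟩

lemma exists_good_s19 {m H : ℕ} (hH : 1 ≤ H) {A : Matrix (Fin (m + 1)) (Fin (m + 1)) ℤ}
    (hA : A ∈ mb m H) (h0 : A.det = 0) :
    ∃ D ∈ bx (m + 1) 1, A + Matrix.diagonal D ∈ mb m H ∧ (A + Matrix.diagonal D).det = 0 ∧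
      ∃ i k, (A + Matrix.diagonal D).adjugate k i ≠ 0 := by
  set s : Fin (m + 1) → ℤ := fun i => if 0 ≤ A i i then -1 else 1 with hs
  obtain ⟨t0, ht0⟩ := exists_diag (m + 1) A s fun i => by simp only [hs]; split_ifs <;> simp
  have key : ∀ t : Finset (Fin (m + 1)),
      (A + Matrix.diagonal fun i => if i ∈ t then s i else 0).det ≠ 0 →
      ∃ t' : Finset (Fin (m + 1)),
        (A + Matrix.diagonal fun i => if i ∈ t' then s i else 0).det = 0 ∧
        ∃ i, (A + Matrix.diagonal fun i => if i ∈ t' then s i else 0).adjugate i i ≠ 0 := by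
    intro t
    induction t using Finset.induction_on with
    | empty => intro h; exact absurd (by simpa using h0) h
    | insert i t hi ih =>
      intro h
      by_cases hz : (A + Matrix.diagonal fun i => if i ∈ t then s i else 0).det = 0
      · refine ⟨t, hz, i, ?_⟩
        intro hadj
        apply h
        have : (A + Matrix.diagonal fun j => if j ∈ insert i t then s j else 0)
            = (A + Matrix.diagonal fun i => if i ∈ t then s i else 0)
              + Matrix.diagonal (Pi.single i (s i)) := by
          rw [add_assoc, Matrix.diagonal_add]
          congr 2
          funext j
          by_cases hj : j = i
          · subst hj; simp [hi]
          · simp [hj]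
        rw [this, det_add_diag, hz, hadj]
        simp
      · exact ih hz
  obtain ⟨t, ht, i, hi⟩ := key t0 ht0
  refine ⟨fun i => if i ∈ t then s i else 0, ?_, ?_, ht, i, i, hi⟩
  · rw [mem_bx]
    intro j
    simp only [hs]
    split_ifs <;> simp
  · rw [mem_mb]
    intro r c
    have hrc := mem_mb.1 hA r c
    by_cases h : r = c
    · subst h
      rw [abs_le] at *
      simp only [Matrix.add_apply, Matrix.diagonal_apply_eq, hs]
      split_ifs <;> constructor <;> omega
    · simpa [Matrix.diagonal_apply_ne _ h] using hrc

open Classical in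
lemma count_good {m H : ℕ} (hH : 1 ≤ H) (d : ℤ) :
    (((mb m H).filter fun A => A.det = d ∧ ∃ i k, A.adjugate k i ≠ 0).card : ℝ) ≤
      ((m + 1) * (m + 1) : ℕ) * (3 ^ m * ((2 * ((m + 2) * H) + 1) ^ m) ^ (m + 1) *
        (2 * (1 + Real.log (((m + 1).factorial * H ^ (m + 1) : ℕ) : ℝ)))) := by
  have hsub : ((mb m H).filter fun A => A.det = d ∧ ∃ i k, A.adjugate k i ≠ 0) ⊆
      (Finset.univ : Finset (Fin (m + 1) × Fin (m + 1))).biUnion fun p =>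
        (mb m H).filter fun A => A.det = d ∧ A.adjugate p.2 p.1 ≠ 0 ∧
          ∀ l, |A.adjugate l p.1| ≤ |A.adjugate p.2 p.1| := by
    intro A hA
    obtain ⟨hmem, hdet, i, k, hne⟩ := Finset.mem_filter.1 hA
    obtain ⟨k', hk'⟩ := Finite.exists_max fun l => |A.adjugate l i|
    refine Finset.mem_biUnion.2 ⟨(i, k'), Finset.mem_univ _, Finset.mem_filter.2
      ⟨hmem, hdet, ?_, hk'⟩⟩
    have := (abs_pos.2 hne).trans_le (hk' k)
    exact abs_pos.1 this
  have h1 := (Finset.card_le_card hsub).trans Finset.card_biUnion_le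
  have h2 : (((mb m H).filter fun A => A.det = d ∧ ∃ i k, A.adjugate k i ≠ 0).card : ℝ) ≤
      ∑ p : Fin (m + 1) × Fin (m + 1), (((mb m H).filter fun A => A.det = d ∧
        A.adjugate p.2 p.1 ≠ 0 ∧ ∀ l, |A.adjugate l p.1| ≤ |A.adjugate p.2 p.1|).card : ℝ) := by
    exact_mod_cast h1
  refine h2.trans ((Finset.sum_le_card_nsmul _ _ _ fun p _ => count_ik hH p.1 p.2 d).trans ?_)
  rw [Finset.card_univ, Fintype.card_prod, Fintype.card_fin, nsmul_eq_mul]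

open Classical in
lemma card_det_le {m H : ℕ} (hH : 1 ≤ H) (d : ℤ) :
    ((mb m H).filter fun A => A.det = d).card ≤ 3 ^ (m + 1) *
      ((mb m H).filter fun A => A.det = d ∧ ∃ i k, A.adjugate k i ≠ 0).card := by
  set G := (mb m H).filter fun A => A.det = d ∧ ∃ i k, A.adjugate k i ≠ 0 with hG
  have hc : (bx (m + 1) 1).card = 3 ^ (m + 1) := by rw [card_bx]
  have hsub : ((mb m H).filter fun A => A.det = d) ⊆
      (bx (m + 1) 1 ×ˢ G).image fun p => p.2 - Matrix.diagonal p.1 := by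
    intro A hA
    obtain ⟨hmem, hdet⟩ := Finset.mem_filter.1 hA
    rw [Finset.mem_image]
    by_cases hd : d = 0
    · obtain ⟨D, hD, h1, h2, h3⟩ := exists_good_s19 hH hmem (hdet.trans hd)
      refine ⟨(D, A + Matrix.diagonal D), ?_, by simp⟩
      rw [Finset.mem_product]
      exact ⟨hD, Finset.mem_filter.2 ⟨h1, h2.trans hd.symm, h3⟩⟩
    · refine ⟨(0, A), ?_, by simp⟩
      rw [Finset.mem_product]
      refine ⟨mem_bx.2 (by simp), Finset.mem_filter.2 ⟨hmem, hdet, 0, ?_⟩⟩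
      by_contra! hcon
      have := row_adj A 0 0
      simp only [hcon, mul_zero, Finset.sum_const_zero, if_true] at this
      exact hd (hdet.symm.trans this.symm)
  refine (Finset.card_le_card hsub).trans (Finset.card_image_le.trans ?_)
  rw [Finset.card_product, hc]

lemma final_bound (m : ℕ) : ∃ C : ℝ, 0 < C ∧ ∀ H : ℕ, 2 ≤ H →
    (3 : ℝ) ^ (m + 1) * (((m + 1) * (m + 1) : ℕ) * (3 ^ m * ((2 * ((m + 2) * H) + 1) ^ m) ^ (m + 1) *
        (2 * (1 + Real.log (((m + 1).factorial * H ^ (m + 1) : ℕ) : ℝ))))) ≤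
      C * ((H : ℝ) ^ ((m + 1) ^ 2 - (m + 1)) * Real.log H) := by
  have hl2 : 0 < Real.log 2 := Real.log_pos (by norm_num)
  have hf : (1 : ℝ) ≤ (m + 1).factorial := by exact_mod_cast Nat.succ_le_of_lt (Nat.factorial_pos _)
  have hlf : 0 ≤ Real.log ((m + 1).factorial : ℝ) := Real.log_nonneg hf
  set L : ℝ := (1 + Real.log ((m + 1).factorial : ℝ)) / Real.log 2 + (m + 1) with hL
  have hLpos : 0 < L := by positivity
  refine ⟨3 ^ (m + 1) * (((m + 1) * (m + 1) : ℕ) * (3 ^ m * (2 * m + 5 : ℝ) ^ (m * (m + 1)) *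
    (2 * L))), by positivity, fun H hH => ?_⟩
  have hH' : (2 : ℝ) ≤ H := by exact_mod_cast hH
  have hlog : Real.log 2 ≤ Real.log H := Real.log_le_log (by norm_num) hH'
  have e : (m + 1) ^ 2 - (m + 1) = m * (m + 1) := by
    rw [Nat.sub_eq_iff_eq_add (by nlinarith)]; ring
  have h1 : ((2 * ((m + 2) * (H : ℝ)) + 1) ^ m) ^ (m + 1) ≤
      (2 * m + 5 : ℝ) ^ (m * (m + 1)) * (H : ℝ) ^ (m * (m + 1)) := by
    rw [← pow_mul, ← mul_pow]
    apply pow_le_pow_left₀ (by positivity)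
    nlinarith
  have h2 : 1 + Real.log (((m + 1).factorial * H ^ (m + 1) : ℕ) : ℝ) ≤ L * Real.log H := by
    push_cast
    rw [Real.log_mul (by positivity) (by positivity), Real.log_pow, hL, add_mul]
    have : 1 + Real.log ((m + 1).factorial : ℝ) ≤
        (1 + Real.log ((m + 1).factorial : ℝ)) / Real.log 2 * Real.log H := by
      rw [div_mul_eq_mul_div, le_div_iff₀ hl2]
      exact mul_le_mul_of_nonneg_left hlog (by positivity)
    push_cast
    linarith
  have h2' : 0 ≤ Real.log (((m + 1).factorial * H ^ (m + 1) : ℕ) : ℝ) := Real.log_natCast_nonneg _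
  rw [e]
  calc _ ≤ (3 : ℝ) ^ (m + 1) * (((m + 1) * (m + 1) : ℕ) * (3 ^ m *
        ((2 * m + 5 : ℝ) ^ (m * (m + 1)) * (H : ℝ) ^ (m * (m + 1))) *
        (2 * (L * Real.log H)))) := by gcongr
    _ = _ := by ring

/-- Small-determinant count (Section 5.3): the number of matrices `A ∈ M_n(ℤ;H)` with
`|det A| ≤ T` is `O((T+1) H^(n²-n) log H)`. -/
theorem small_determinant_count (n : ℕ) (hn : 1 ≤ n) :
    ∃ C : ℝ, 0 < C ∧ ∀ H : ℕ, 2 ≤ H → ∀ T : ℝ, 0 ≤ T →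
      (Set.ncard {A : Matrix (Fin n) (Fin n) ℤ | (∀ i j, |A i j| ≤ (H : ℤ)) ∧
        |(A.det : ℝ)| ≤ T} : ℝ) ≤
      C * (T + 1) * (H : ℝ) ^ (n ^ 2 - n) * Real.log H := by
  classical
  obtain ⟨m, rfl⟩ : ∃ m, n = m + 1 := ⟨n - 1, by omega⟩
  obtain ⟨C, hC, hb⟩ := final_bound m
  refine ⟨2 * C, by positivity, fun H hH T hT => ?_⟩
  set R := (H : ℝ) ^ ((m + 1) ^ 2 - (m + 1)) * Real.log H with hR
  have hR0 : 0 ≤ R := mul_nonneg (by positivity) (Real.log_natCast_nonneg _)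
  set N := ⌊T⌋₊ with hN
  have hF : ∀ d : ℤ, (((mb m H).filter fun A => A.det = d).card : ℝ) ≤ C * R := by
    intro d
    have hH1 : 1 ≤ H := by omega
    refine le_trans ?_ (hb H hH)
    refine le_trans ?_ (mul_le_mul_of_nonneg_left (count_good hH1 d) (by positivity))
    exact_mod_cast card_det_le hH1 d
  have hsub : {A : Matrix (Fin (m + 1)) (Fin (m + 1)) ℤ | (∀ i j, |A i j| ≤ (H : ℤ)) ∧
        |(A.det : ℝ)| ≤ T} ⊆ (((Finset.Icc (-(N : ℤ)) N).biUnion fun d =>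
          (mb m H).filter fun A => A.det = d : Finset (Matrix (Fin (m + 1)) (Fin (m + 1)) ℤ)) :
          Set (Matrix (Fin (m + 1)) (Fin (m + 1)) ℤ)) := by
    rintro A ⟨h1, h2⟩
    rw [Finset.mem_coe, Finset.mem_biUnion]
    refine ⟨A.det, ?_, Finset.mem_filter.2 ⟨mem_mb.2 h1, rfl⟩⟩
    rw [Finset.mem_Icc, ← abs_le, ← Int.natCast_natAbs]
    have : A.det.natAbs ≤ N := by
      rw [hN]
      apply Nat.le_floor
      rw [Nat.cast_natAbs]
      rw [Int.cast_abs]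
      exact h2
    exact_mod_cast this
  have h1 := Set.ncard_le_ncard hsub (Finset.finite_toSet _)
  rw [Set.ncard_coe_finset] at h1
  have h2 := h1.trans Finset.card_biUnion_le
  have h3 : (Set.ncard {A : Matrix (Fin (m + 1)) (Fin (m + 1)) ℤ | (∀ i j, |A i j| ≤ (H : ℤ)) ∧
        |(A.det : ℝ)| ≤ T} : ℝ) ≤ ∑ d ∈ Finset.Icc (-(N : ℤ)) N,
          (((mb m H).filter fun A => A.det = d).card : ℝ) := by exact_mod_cast h2
  refine h3.trans ((Finset.sum_le_card_nsmul _ _ _ fun d _ => hF d).trans ?_)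
  have hc : (Finset.Icc (-(N : ℤ)) N).card = 2 * N + 1 := by
    rw [Int.card_Icc]; omega
  rw [hc, nsmul_eq_mul]
  have hNT : (N : ℝ) ≤ T := Nat.floor_le hT
  calc ((2 * N + 1 : ℕ) : ℝ) * (C * R) ≤ (2 * (T + 1)) * (C * R) := by
        apply mul_le_mul_of_nonneg_right _ (by positivity)
        push_cast
        linarith
    _ = _ := by rw [hR]; ring
end
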